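/- arXiv:math/0611490 — 9 statements merged into one kernel-verified Lean document; each statement's English description precedes it below -/
import Mathlib

section
/- (Erdős–Gallai, upper bound) Let k ≥ 1 and n ≥ 2k, and let G be a simple graph on n vertices. If the number of edges of G is strictly greater than max{(2k-1 choose 2), (k-1 choose 2) + (k-1)(n-k+1)}, then G contains a matching of size k. -/
/-- `G` contains a matching of size `k`: a set of `k` pairwise disjoint edges of `G`. -/
def HasMatchingOfSize {V : Type*} (G : SimpleGraph V) (k : ℕ) : Prop :=
  ∃ s : Finset (Sym2 V), s.card = k ∧ (∀ e ∈ s, e ∈ G.edgeSet) ∧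
    (s : Set (Sym2 V)).Pairwise fun e f => ∀ v, v ∈ e → v ∉ f

open Finset

namespace Sym2

variable {V : Type*} [DecidableEq V]

/-- The edges of the family `E` contain `k` pairwise disjoint ones. -/
def ContainsMatching (E : Finset (Sym2 V)) (k : ℕ) : Prop :=
  ∃ s ⊆ E, s.card = k ∧ (s : Set (Sym2 V)).Pairwise fun e f => ∀ v, v ∈ e → v ∉ f

/-- The shift of a single edge `e` of the family `E`: replace `j` by `i` whenever `e` contains `j`
but not `i` and the resulting edge is not in `E`. -/
def shiftEdge (i j : V) (E : Finset (Sym2 V)) (e : Sym2 V) : Sym2 V :=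
  if j ∈ e ∧ i ∉ e ∧ e.map (Equiv.swap i j) ∉ E then e.map (Equiv.swap i j) else e

/-- The shift of the family `E` from `j` to `i`. -/
def shift (i j : V) (E : Finset (Sym2 V)) : Finset (Sym2 V) :=
  E.image (shiftEdge i j E)

lemma map_swap_injective (i j : V) : Function.Injective (Sym2.map (Equiv.swap i j)) :=
  Sym2.map.injective (Equiv.injective _)

lemma map_swap_map_swap (i j : V) (e : Sym2 V) :
    (e.map (Equiv.swap i j)).map (Equiv.swap i j) = e := by
  induction e with | _ a b => simp

lemma map_swap_of_notMem {i j : V} {e : Sym2 V} (hi : i ∉ e) (hj : j ∉ e) :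
    e.map (Equiv.swap i j) = e := by
  induction e with
  | _ a b =>
    simp only [Sym2.mem_iff, not_or] at hi hj
    simp only [Sym2.map_mk]
    rw [Equiv.swap_apply_of_ne_of_ne (Ne.symm hi.1) (Ne.symm hj.1),
      Equiv.swap_apply_of_ne_of_ne (Ne.symm hi.2) (Ne.symm hj.2)]

lemma mem_map_swap {i j v : V} {e : Sym2 V} :
    v ∈ e.map (Equiv.swap i j) ↔ Equiv.swap i j v ∈ e := by
  rw [Sym2.mem_map]
  constructor
  · rintro ⟨a, ha, rfl⟩
    simpa using ha
  · exact fun h => ⟨_, h, by simp⟩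

lemma card_shift (i j : V) (E : Finset (Sym2 V)) : (shift i j E).card = E.card := by
  refine card_image_of_injOn fun e he f hf hef => ?_
  simp only [shiftEdge] at hef
  split_ifs at hef with h₁ h₂ h₂
  · exact map_swap_injective i j hef
  · exact absurd (hef ▸ hf) h₁.2.2
  · exact absurd (hef ▸ he) h₂.2.2
  · exact hef

lemma not_isDiag_of_mem_shift {i j : V} {E : Finset (Sym2 V)} (hE : ∀ e ∈ E, ¬ e.IsDiag)
    {e : Sym2 V} (he : e ∈ shift i j E) : ¬ e.IsDiag := by
  obtain ⟨f, hf, rfl⟩ := mem_image.1 he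
  have := hE f hf
  unfold shiftEdge
  split_ifs
  · induction f with | _ a b => simpa using this
  · exact this

/-- An edge of the shifted family is old, or arises from an old edge by replacing `j` by `i`. -/
lemma mem_or_of_mem_shift {i j : V} {E : Finset (Sym2 V)} {e : Sym2 V} (he : e ∈ shift i j E) :
    e ∈ E ∨ (i ∈ e ∧ j ∉ e ∧ e.map (Equiv.swap i j) ∈ E) := by
  obtain ⟨f, hf, rfl⟩ := mem_image.1 he
  unfold shiftEdge
  split_ifs with h
  · right
    simp only [mem_map_swap, Equiv.swap_apply_left, Equiv.swap_apply_right, map_swap_map_swap]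
    exact ⟨h.1, h.2.1, hf⟩
  · exact Or.inl hf

lemma map_swap_mem_of_mem_shift {i j : V} {E : Finset (Sym2 V)} {e : Sym2 V}
    (he : e ∈ shift i j E) (hj : j ∈ e) (hi : i ∉ e) : e.map (Equiv.swap i j) ∈ E := by
  obtain ⟨f, hf, rfl⟩ := mem_image.1 he
  unfold shiftEdge at hj hi ⊢
  split_ifs at hj hi ⊢ with h
  · simp only [mem_map_swap, Equiv.swap_apply_right] at hj
    exact absurd hj h.2.1
  · by_contra hE
    exact h ⟨hj, hi, hE⟩

/-- Shifting does not create larger matchings. -/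
lemma ContainsMatching.of_shift {i j : V} {E : Finset (Sym2 V)} {k : ℕ}
    (h : ContainsMatching (shift i j E) k) : ContainsMatching E k := by
  obtain ⟨s, hs, hk, hd⟩ := h
  by_cases hsE : s ⊆ E
  · exact ⟨s, hsE, hk, hd⟩
  obtain ⟨e, hes, heE⟩ := not_subset.1 hsE
  obtain ⟨hie, hje, heE'⟩ := (mem_or_of_mem_shift (hs hes)).resolve_left heE
  refine ⟨s.image (Sym2.map (Equiv.swap i j)), ?_, ?_, ?_⟩
  · intro g hg
    obtain ⟨f, hf, rfl⟩ := mem_image.1 hg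
    obtain rfl | hne := eq_or_ne e f
    · exact heE'
    have hif : i ∉ f := hd hes hf hne i hie
    by_cases hjf : j ∈ f
    · exact map_swap_mem_of_mem_shift (hs hf) hjf hif
    · rw [map_swap_of_notMem hif hjf]
      exact (mem_or_of_mem_shift (hs hf)).resolve_right fun h => hif h.1
  · rw [card_image_of_injective _ (map_swap_injective i j), hk]
  · intro a ha b hb hab v hva hvb
    obtain ⟨e, he, rfl⟩ := mem_image.1 (mem_coe.1 ha)
    obtain ⟨f, hf, rfl⟩ := mem_image.1 (mem_coe.1 hb)
    rw [mem_map_swap] at hva hvb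
    exact hd he hf (fun h => hab (congrArg _ h)) _ hva hvb

/-- The sum of the labels of the endpoints of an edge. -/
def labelSum {n : ℕ} : Sym2 (Fin n) → ℕ :=
  Sym2.lift ⟨fun a b => (a : ℕ) + b, fun _ _ => Nat.add_comm _ _⟩

@[simp] lemma labelSum_mk {n : ℕ} (a b : Fin n) : labelSum s(a, b) = (a : ℕ) + b := rfl

lemma labelSum_map_swap_lt {n : ℕ} {i j : Fin n} (hij : i < j) {e : Sym2 (Fin n)}
    (hd : ¬ e.IsDiag) (hj : j ∈ e) (hi : i ∉ e) :
    labelSum (e.map (Equiv.swap i j)) < labelSum e := by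
  obtain ⟨x, rfl⟩ := Sym2.mem_iff_exists.1 hj
  have hxj : x ≠ j := fun h => hd (by simp [h])
  have hxi : x ≠ i := fun h => hi (by simp [h])
  simp only [Sym2.map_mk, Equiv.swap_apply_right, Equiv.swap_apply_of_ne_of_ne hxi hxj,
    labelSum_mk]
  have : (i : ℕ) < j := hij
  lia

lemma sum_labelSum_shift_lt {n : ℕ} {i j : Fin n} (hij : i < j) {E : Finset (Sym2 (Fin n))}
    (hE : ∀ e ∈ E, ¬ e.IsDiag) {e : Sym2 (Fin n)} (he : e ∈ E) (hj : j ∈ e) (hi : i ∉ e)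
    (heE : e.map (Equiv.swap i j) ∉ E) :
    ∑ f ∈ shift i j E, labelSum f < ∑ f ∈ E, labelSum f := by
  have hinj : Set.InjOn (shiftEdge i j E) E := card_image_iff.1 (card_shift i j E)
  rw [shift, sum_image hinj]
  refine sum_lt_sum (fun f hf => ?_) ⟨e, he, ?_⟩
  · unfold shiftEdge
    split_ifs with h
    · exact (labelSum_map_swap_lt hij (hE f hf) h.1 h.2.1).le
    · exact le_rfl
  · rw [shiftEdge, if_pos ⟨hj, hi, heE⟩]
    exact labelSum_map_swap_lt hij (hE e he) hj hi

/-- A family of edges on `Fin n` without a matching of size `k` can be replaced by a stable one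
of the same size. -/
lemma exists_stable_of_not_containsMatching {n k : ℕ} {E : Finset (Sym2 (Fin n))}
    (hE : ∀ e ∈ E, ¬ e.IsDiag) (hk : ¬ ContainsMatching E k) :
    ∃ F : Finset (Sym2 (Fin n)), F.card = E.card ∧ (∀ e ∈ F, ¬ e.IsDiag) ∧
      ¬ ContainsMatching F k ∧ ∀ i j x : Fin n, i ≤ j → x ≠ i → s(j, x) ∈ F → s(i, x) ∈ F := by
  induction hw : ∑ f ∈ E, labelSum f using Nat.strong_induction_on generalizing E with
  | _ w ih =>
    by_cases hst : ∀ i j x : Fin n, i ≤ j → x ≠ i → s(j, x) ∈ E → s(i, x) ∈ E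
    · exact ⟨E, rfl, hE, hk, hst⟩
    push Not at hst
    obtain ⟨i, j, x, hij, hxi, hjx, hix⟩ := hst
    have hne : i ≠ j := fun h => hix (h ▸ hjx)
    have hxj : x ≠ j := fun h => hE _ hjx (by simp [h])
    have hlt := sum_labelSum_shift_lt (lt_of_le_of_ne hij hne) hE hjx (by simp)
      (by simp [hne, hxi.symm])
      (by simpa [Equiv.swap_apply_of_ne_of_ne hxi hxj] using hix)
    obtain ⟨F, hF, h⟩ := ih _ (hw ▸ hlt) (fun e he => not_isDiag_of_mem_shift hE he)
      (fun h => hk h.of_shift) rfl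
    exact ⟨F, hF.trans (card_shift i j E), h⟩

/-- If no set of `k` edges of `F` is a matching, then one of the edges `s(i, 2k - 1 - i)` of the
nested matching is missing. -/
lemma exists_notMem_of_not_containsMatching {n k : ℕ} (hn : 2 * k ≤ n)
    {F : Finset (Sym2 (Fin n))} (hF : ¬ ContainsMatching F k) :
    ∃ a b : Fin n, (a : ℕ) < k ∧ (a : ℕ) + b + 1 = 2 * k ∧ s(a, b) ∉ F := by
  by_contra! h
  let e : Fin k → Sym2 (Fin n) := fun t => s(⟨t, by lia⟩, ⟨2 * k - 1 - t, by lia⟩)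
  have hdisj : ∀ t u : Fin k, ∀ v, v ∈ e t → v ∈ e u → t = u := by
    intro t u v ht hu
    simp only [e, Sym2.mem_iff, Fin.ext_iff] at ht hu ⊢
    lia
  have hinj : Function.Injective e := fun t u htu =>
    hdisj t u ⟨t, by lia⟩ (by simp [e]) (by rw [← htu]; simp [e])
  refine hF ⟨univ.image e, ?_, ?_, ?_⟩
  · intro f hf
    obtain ⟨t, -, rfl⟩ := mem_image.1 hf
    exact h _ _ t.2 (by simp only; lia)
  · rw [card_image_of_injective _ hinj, card_univ, Fintype.card_fin]
  · intro a ha b hb hab v hva hvb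
    obtain ⟨t, -, rfl⟩ := mem_image.1 (mem_coe.1 ha)
    obtain ⟨u, -, rfl⟩ := mem_image.1 (mem_coe.1 hb)
    exact hab (congrArg e (hdisj t u v hva hvb))

/-- A family in which every edge meets `Iio a` or lies in `Iio b` is small. -/
lemma card_le_of_forall_lt_or_lt {n : ℕ} {a b : Fin n}
    {F : Finset (Sym2 (Fin n))} (hd : ∀ e ∈ F, ¬ e.IsDiag)
    (hF : ∀ x y : Fin n, x < y → s(x, y) ∈ F → x < a ∨ y < b) :
    F.card ≤ (a : ℕ).choose 2 + a * (n - a) + ((b : ℕ) - a).choose 2 := by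
  have hsub : F ⊆ (Iio a).offDiag.image (Function.uncurry Sym2.mk) ∪
      (Iio a ×ˢ Ici a).image (Function.uncurry Sym2.mk) ∪
      (Ico a b).offDiag.image (Function.uncurry Sym2.mk) := by
    have key : ∀ x y : Fin n, x < y → s(x, y) ∈ F →
        s(x, y) ∈ (Iio a).offDiag.image (Function.uncurry Sym2.mk) ∪
      (Iio a ×ˢ Ici a).image (Function.uncurry Sym2.mk) ∪
      (Ico a b).offDiag.image (Function.uncurry Sym2.mk) := by
      intro x y hxy hmem
      simp only [mem_union]
      by_cases hxa : x < a
      · left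
        by_cases hya : y < a
        · exact Or.inl (mem_image.2 ⟨(x, y), by simp [hxa, hya, hxy.ne], rfl⟩)
        · exact Or.inr (mem_image.2 ⟨(x, y), by simp [hxa, not_lt.1 hya], rfl⟩)
      · have hyb := (hF x y hxy hmem).resolve_left hxa
        have hax := not_lt.1 hxa
        exact Or.inr (mem_image.2
          ⟨(x, y), by simp [hax, hyb, hxy.ne, hxy.trans hyb, hax.trans hxy.le], rfl⟩)
    intro e he
    induction e with
    | _ x y =>
      rcases lt_trichotomy x y with h | h | h
      · exact key x y h he
      · exact absurd (by simp [h]) (hd _ he)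
      · rw [Sym2.eq_swap] at he ⊢
        exact key y x h he
  calc F.card ≤ _ := card_le_card hsub
    _ ≤ _ := card_union_le _ _
    _ ≤ _ := Nat.add_le_add (card_union_le _ _) le_rfl
    _ ≤ _ := by
      refine Nat.add_le_add (Nat.add_le_add ?_ (card_image_le.trans ?_)) ?_
      · rw [Sym2.card_image_offDiag, Fin.card_Iio]
      · rw [card_product, Fin.card_Iio, Fin.card_Ici]
      · rw [Sym2.card_image_offDiag, Fin.card_Ico]

end Sym2

/-- The maximum of the convex bound is attained at one of the ends `i = 0`, `i = m`. -/
lemma choose_two_add_mul_add_choose_two_le_max {n m i : ℕ} (hi : i ≤ m) (hm : m ≤ n) :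
    i.choose 2 + i * (n - i) + (2 * m + 1 - 2 * i).choose 2 ≤
      max ((2 * m + 1).choose 2) (m.choose 2 + m * (n - m)) := by
  obtain ⟨d, rfl⟩ := Nat.exists_eq_add_of_le hi
  obtain ⟨c, rfl⟩ := Nat.exists_eq_add_of_le hm
  rw [show 2 * (i + d) + 1 - 2 * i = 2 * d + 1 by lia, show i + d + c - i = d + c by lia,
    show i + d + c - (i + d) = c by lia, le_max_iff]
  by_contra! h
  obtain ⟨h₁, h₂⟩ := h
  rw [← Nat.cast_lt (α := ℚ)] at h₁ h₂
  push_cast [Nat.cast_choose_two] at h₁ h₂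
  have hi0 : (0 : ℚ) ≤ i := Nat.cast_nonneg i
  have hd0 : (0 : ℚ) ≤ d := Nat.cast_nonneg d
  have hc : (3 * i + 6 * d + 3 : ℚ) < 2 * c := by
    by_contra! hc
    nlinarith [mul_le_mul_of_nonneg_left hc hi0]
  have hc' : (2 * c : ℚ) < 3 * d + 3 := by
    by_contra! hc'
    nlinarith [mul_le_mul_of_nonneg_left hc' hd0]
  linarith

/-- Erdős–Gallai, upper bound: if a graph on `n` vertices has more than
`max{C(2k-1,2), C(k-1,2)+(k-1)(n-k+1)}` edges, it contains a matching of size `k`. -/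
theorem erdos_gallai_upper (n k : ℕ) (hk : 1 ≤ k) (hn : 2 * k ≤ n)
    (G : SimpleGraph (Fin n))
    (h : max (Nat.choose (2 * k - 1) 2) (Nat.choose (k - 1) 2 + (k - 1) * (n - k + 1))
      < G.edgeSet.ncard) :
    HasMatchingOfSize G k := by
  classical
  by_contra hG
  have hE : ¬ Sym2.ContainsMatching G.edgeFinset k := fun ⟨s, hs, hc, hd⟩ =>
    hG ⟨s, hc, fun e he => SimpleGraph.mem_edgeFinset.1 (hs he), hd⟩
  obtain ⟨F, hcard, hdiag, hF, hst⟩ := Sym2.exists_stable_of_not_containsMatching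
    (fun e he => G.not_isDiag_of_mem_edgeSet (SimpleGraph.mem_edgeFinset.1 he)) hE
  obtain ⟨a, b, hak, hab, hnot⟩ := Sym2.exists_notMem_of_not_containsMatching hn hF
  have hbound := Sym2.card_le_of_forall_lt_or_lt (a := a) (b := b) hdiag fun x y hxy hmem => by
    by_contra! hc
    have hay : s(y, a) ∈ F := by
      rw [Sym2.eq_swap]
      exact hst a x y hc.1 (hc.1.trans_lt hxy).ne' hmem
    have hne : a ≠ b := by
      rintro rfl
      lia
    exact hnot (Sym2.eq_swap ▸ hst b y a hc.2 hne hay)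
  have hmax := choose_two_add_mul_add_choose_two_le_max (n := n) (m := k - 1) (i := a)
    (by lia) (by lia)
  rw [show 2 * (k - 1) + 1 - 2 * a = b - a by lia, show 2 * (k - 1) + 1 = 2 * k - 1 by lia,
    show n - (k - 1) = n - k + 1 by lia] at hmax
  rw [← SimpleGraph.coe_edgeFinset, Set.ncard_coe_finset, ← hcard] at h
  exact absurd (h.trans_le (hbound.trans hmax)) (lt_irrefl _)
end

section
/- (Erdős–Gallai, sharpness) For every k ≥ 1 and n ≥ 2k there exists a simple graph G on n vertices with exactly max{(2k-1 choose 2), (k-1 choose 2) + (k-1)(n-k+1)} edges that contains no matching of size k. -/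
theorem add_choose_two (a b : ℕ) :
    (a + b).choose 2 = a.choose 2 + b.choose 2 + a * b := by
  induction b with
  | zero => simp
  | succ b ih =>
    rw [← add_assoc, Nat.choose_succ_succ' (a + b) 1, Nat.choose_succ_succ' b 1, ih,
      Nat.choose_one_right, Nat.choose_one_right]
    ring

/-- The complete graph on `S`, with all vertices outside `S` isolated. -/
def cliqueOn {V : Type*} (S : Finset V) : SimpleGraph V where
  Adj u v := u ≠ v ∧ u ∈ S ∧ v ∈ S
  symm := ⟨fun _ _ h => ⟨h.1.symm, h.2.2, h.2.1⟩⟩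
  loopless := ⟨fun _ h => h.1 rfl⟩

theorem edgeSet_cliqueOn {V : Type*} [DecidableEq V] (S : Finset V) :
    (cliqueOn S).edgeSet = (S.offDiag.image Sym2.mk.uncurry : Finset (Sym2 V)) := by
  ext e
  induction e using Sym2.ind with
  | _ u v =>
    simp only [SimpleGraph.mem_edgeSet, cliqueOn, Finset.coe_image, Set.mem_image,
      Finset.mem_coe, Finset.mem_offDiag, Prod.exists, Function.uncurry, Sym2.eq_iff]
    grind

theorem ncard_edgeSet_cliqueOn {V : Type*} (S : Finset V) :
    (cliqueOn S).edgeSet.ncard = S.card.choose 2 := by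
  classical
  rw [edgeSet_cliqueOn, Set.ncard_coe_finset]
  exact Sym2.card_image_offDiag S

theorem ncard_edgeSet_compl_cliqueOn {V : Type*} [Fintype V] [DecidableEq V] (S : Finset V) :
    (cliqueOn Sᶜ)ᶜ.edgeSet.ncard
      = S.card.choose 2 + S.card * (Fintype.card V - S.card) := by
  classical
  have h : (cliqueOn Sᶜ)ᶜ.edgeSet.ncard + (cliqueOn Sᶜ).edgeSet.ncard
      = (cliqueOn (Finset.univ : Finset V)).edgeSet.ncard := by
    rw [← Set.ncard_union_eq]
    · congr 1
      ext e
      induction e using Sym2.ind with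
      | _ u v => simp [cliqueOn]; tauto
    · rw [SimpleGraph.disjoint_edgeSet]
      exact disjoint_compl_left
  rw [ncard_edgeSet_cliqueOn, ncard_edgeSet_cliqueOn, Finset.card_univ, Finset.card_compl] at h
  obtain ⟨b, hb⟩ := Nat.exists_eq_add_of_le S.card_le_univ
  rw [hb, Nat.add_sub_cancel_left] at h ⊢
  rw [add_choose_two] at h
  omega

theorem two_mul_le_card_of_hasMatchingOfSize_cliqueOn {V : Type*} {S : Finset V} {k : ℕ}
    (h : HasMatchingOfSize (cliqueOn S) k) : 2 * k ≤ S.card := by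
  classical
  obtain ⟨s, rfl, hs, hd⟩ := h
  have hcard : (s.biUnion Sym2.toFinset).card = ∑ e ∈ s, 2 := by
    rw [Finset.card_biUnion]
    · exact Finset.sum_congr rfl fun e he => Sym2.card_toFinset_of_not_isDiag e
        ((cliqueOn S).not_isDiag_of_mem_edgeSet (hs e he))
    · intro e he f hf hef
      rw [Function.onFun, Finset.disjoint_left]
      simpa using hd he hf hef
  have hsub : s.biUnion Sym2.toFinset ⊆ S := by
    intro v hv
    obtain ⟨e, he, hve⟩ := Finset.mem_biUnion.1 hv
    obtain ⟨w, rfl⟩ := Sym2.mem_toFinset.1 hve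
    exact (hs _ he).2.1
  have := Finset.card_le_card hsub
  rw [hcard, Finset.sum_const, smul_eq_mul] at this
  omega

theorem le_card_of_hasMatchingOfSize_compl_cliqueOn {V : Type*} [Fintype V] [DecidableEq V]
    {S : Finset V} {k : ℕ} (h : HasMatchingOfSize (cliqueOn Sᶜ)ᶜ k) : k ≤ S.card := by
  obtain ⟨s, rfl, hs, hd⟩ := h
  have hex : ∀ e ∈ s, ∃ v ∈ S, v ∈ e := by
    intro e he
    have := hs e he
    induction e using Sym2.ind with
    | _ u v =>
      simp only [cliqueOn, SimpleGraph.mem_edgeSet, SimpleGraph.compl_adj,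
        Finset.mem_compl, Sym2.mem_iff] at this ⊢
      grind
  refine Finset.card_le_card_of_forall_subsingleton (fun e v => v ∈ e) hex ?_
  rintro v - e ⟨he, hve⟩ f ⟨hf, hvf⟩
  by_contra hne
  exact hd he hf hne v hve hvf

/-- Erdős–Gallai, sharpness: for every `k ≥ 1` and `n ≥ 2k` there is a graph on `n` vertices
with exactly `max{C(2k-1,2), C(k-1,2)+(k-1)(n-k+1)}` edges and no matching of size `k`. -/
theorem erdos_gallai_sharp (n k : ℕ) (hk : 1 ≤ k) (hn : 2 * k ≤ n) :
    ∃ G : SimpleGraph (Fin n),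
      G.edgeSet.ncard
        = max (Nat.choose (2 * k - 1) 2) (Nat.choose (k - 1) 2 + (k - 1) * (n - k + 1)) ∧
      ¬ HasMatchingOfSize G k := by
  have exists_card (m : ℕ) (hm : m ≤ n) : ∃ S : Finset (Fin n), S.card = m := by
    obtain ⟨S, -, hS⟩ := Finset.exists_subset_card_eq
      (s := (Finset.univ : Finset (Fin n))) (n := m) (by simpa using hm)
    exact ⟨S, hS⟩
  rcases max_choice (Nat.choose (2 * k - 1) 2)
    (Nat.choose (k - 1) 2 + (k - 1) * (n - k + 1)) with h | h <;> rw [h]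
  · obtain ⟨S, hS⟩ := exists_card (2 * k - 1) (by omega)
    refine ⟨cliqueOn S, by rw [ncard_edgeSet_cliqueOn, hS], fun hM => ?_⟩
    have := two_mul_le_card_of_hasMatchingOfSize_cliqueOn hM
    omega
  · obtain ⟨S, hS⟩ := exists_card (k - 1) (by omega)
    refine ⟨(cliqueOn Sᶜ)ᶜ, ?_, fun hM => ?_⟩
    · rw [ncard_edgeSet_compl_cliqueOn, hS, Fintype.card_fin,
        show n - (k - 1) = n - k + 1 by omega]
    · have := le_card_of_hasMatchingOfSize_compl_cliqueOn hM
      omega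
end

section
/- (Ore's defect formula) Let G be a finite bipartite graph with bipartition (A, B) and let M be a maximum matching of G. Then the size of M equals |A| - d, where d = max over all subsets S of A of (|S| - |N_G(S)|), and N_G(S) denotes the set of vertices of G adjacent to at least one vertex of S. -/
/-- `s` is a matching of the graph `G`: a set of pairwise disjoint edges of `G`. -/
def IsMatchingFinset {V : Type*} (G : SimpleGraph V) (s : Finset (Sym2 V)) : Prop :=
  (∀ e ∈ s, e ∈ G.edgeSet) ∧ (s : Set (Sym2 V)).Pairwise fun e f => ∀ v, v ∈ e → v ∉ f

/-- A defect version of Hall's marriage theorem. -/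
theorem exists_injective_of_card_le_biUnion_add {ι α : Type*} [Fintype ι] [DecidableEq α]
    (t : ι → Finset α) (d : ℕ) (h : ∀ S : Finset ι, S.card ≤ (S.biUnion t).card + d) :
    ∃ T : Finset ι, Fintype.card ι ≤ T.card + d ∧
      ∃ g : T → α, Function.Injective g ∧ ∀ x : T, g x ∈ t x := by
  classical
  obtain ⟨f, hf, hft⟩ := (Finset.all_card_le_biUnion_card_iff_exists_injective
    (fun x => (t x).disjSum (Finset.univ : Finset (Fin d)))).1 (by
      intro S
      rcases S.eq_empty_or_nonempty with rfl | ⟨x, hx⟩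
      · simp
      · have hS : S.biUnion (fun x => (t x).disjSum (Finset.univ : Finset (Fin d))) =
            (S.biUnion t).disjSum Finset.univ := by
          ext (a | b)
          · simp
          · simpa using ⟨x, hx⟩
        rw [hS, Finset.card_disjSum, Finset.card_univ, Fintype.card_fin]
        exact h S)
  refine ⟨Finset.univ.filter fun x => (f x).isLeft = true, ?_,
    fun x => (f x).getLeft (Finset.mem_filter.1 x.2).2, ?_, ?_⟩
  · rw [← Finset.card_univ, ← Finset.card_filter_add_card_filter_not
      (s := Finset.univ) (fun x => (f x).isLeft = true)]
    gcongr
    calc _ = ((Finset.univ.filter fun x => ¬ (f x).isLeft = true).image f).card :=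
          (Finset.card_image_of_injective _ hf).symm
      _ ≤ ((Finset.univ : Finset (Fin d)).map Function.Embedding.inr).card := by
          refine Finset.card_le_card fun y hy => ?_
          obtain ⟨x, hx, rfl⟩ := Finset.mem_image.1 hy
          cases hfx : f x <;> simp_all
      _ = d := by simp
  · intro x y hxy
    refine Subtype.ext (hf ?_)
    rw [← Sum.inl_getLeft (f x) (Finset.mem_filter.1 x.2).2,
      ← Sum.inl_getLeft (f y) (Finset.mem_filter.1 y.2).2]
    exact congrArg Sum.inl hxy
  · intro x
    have hx := hft x
    rw [← Sum.inl_getLeft (f x) (Finset.mem_filter.1 x.2).2] at hx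
    exact Finset.inl_mem_disjSum.1 hx

/-- A matching has at most as many edges as a vertex cover has vertices. -/
theorem IsMatchingFinset.card_le_of_cover {V : Type*} {G : SimpleGraph V}
    {M : Finset (Sym2 V)} (hM : IsMatchingFinset G M) (C : Finset V)
    (hC : ∀ e ∈ G.edgeSet, ∃ v ∈ C, v ∈ e) : M.card ≤ C.card := by
  refine Finset.card_le_card_of_forall_subsingleton (fun e v => v ∈ e)
    (fun e he => hC e (hM.1 e he)) ?_
  rintro v - e ⟨he, hve⟩ f ⟨hf, hvf⟩
  by_contra hne
  exact hM.2 he hf hne v hve hvf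

/-- If every `S ⊆ A` satisfies `|S| ≤ |N(S)| + d`, then there is a matching with at least
`|A| - d` edges. -/
theorem exists_isMatchingFinset_of_card_le {V : Type*} [DecidableEq V] [Fintype V]
    (G : SimpleGraph V) (A : Finset V) (hA : ∀ u ∈ A, ∀ v ∈ A, ¬ G.Adj u v) (d : ℕ)
    (h : ∀ S ⊆ A, S.card ≤ {v : V | ∃ u ∈ S, G.Adj u v}.ncard + d) :
    ∃ s : Finset (Sym2 V), IsMatchingFinset G s ∧ A.card ≤ s.card + d := by
  classical
  obtain ⟨T, hT, g, hg, hgt⟩ := exists_injective_of_card_le_biUnion_add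
    (fun a : A => G.neighborFinset a) d (by
      intro S
      have hS := h (S.map (Function.Embedding.subtype _)) (by
        intro x hx
        obtain ⟨a, -, rfl⟩ := Finset.mem_map.1 hx
        exact a.2)
      rw [Finset.card_map] at hS
      convert hS using 2
      rw [← Set.ncard_coe_finset]
      congr 1
      ext v
      simp)
  have hadj : ∀ x : T, G.Adj x.1 (g x) := fun x => by simpa using hgt x
  have hne : ∀ x y : T, (x.1 : V) ≠ g y := fun x y hxy =>
    hA y.1 y.1.2 x.1 x.1.2 (hxy ▸ hadj y)
  have hval : ∀ x y : T, (x.1 : V) = y.1 → x = y := fun x y hxy =>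
    Subtype.ext (Subtype.ext hxy)
  refine ⟨Finset.univ.image fun x : T => s((x.1 : V), g x), ⟨?_, ?_⟩, ?_⟩
  · intro e he
    obtain ⟨x, -, rfl⟩ := Finset.mem_image.1 he
    exact hadj x
  · intro e he f hf hef v hve hvf
    obtain ⟨x, -, rfl⟩ := Finset.mem_image.1 he
    obtain ⟨y, -, rfl⟩ := Finset.mem_image.1 hf
    have hxy : x ≠ y := fun hxy => hef (by rw [hxy])
    rcases Sym2.mem_iff.1 hve with rfl | rfl <;> rcases Sym2.mem_iff.1 hvf with hv | hv
    · exact hxy (hval _ _ hv)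
    · exact hne _ _ hv
    · exact hne _ _ hv.symm
    · exact hxy (hg hv)
  · rw [Finset.card_image_of_injective]
    · simpa using hT
    · intro x y hxy
      rcases Sym2.eq_iff.1 hxy with ⟨hv, -⟩ | ⟨hv, -⟩
      · exact hval _ _ hv
      · exact (hne _ _ hv).elim

/-- Ore's defect formula: for a finite bipartite graph `G` with bipartition `(A, B)` and a
maximum matching `M`, the size of `M` equals `|A| - d`, where
`d = max {|S| - |N_G(S)| : S ⊆ A}` (the maximum taken over the integers). -/
theorem ore_defect_formula {V : Type*} [Fintype V] [DecidableEq V] (G : SimpleGraph V)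
    (A B : Finset V)
    (hdisj : Disjoint A B) (hcover : A ∪ B = Finset.univ)
    (hbip : ∀ u v, G.Adj u v → (u ∈ A ∧ v ∈ B) ∨ (u ∈ B ∧ v ∈ A))
    (M : Finset (Sym2 V)) (hM : IsMatchingFinset G M)
    (hmax : ∀ s : Finset (Sym2 V), IsMatchingFinset G s → s.card ≤ M.card) :
    (M.card : ℤ) = (A.card : ℤ) -
      A.powerset.sup' ⟨∅, Finset.empty_mem_powerset A⟩
        (fun S => (S.card : ℤ) - ({v : V | ∃ u ∈ S, G.Adj u v}.ncard : ℤ)) := by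
  classical
  set φ : Finset V → ℤ :=
    fun S => (S.card : ℤ) - ({v : V | ∃ u ∈ S, G.Adj u v}.ncard : ℤ) with hφ
  have hAA : ∀ u ∈ A, ∀ v ∈ A, ¬ G.Adj u v := by
    intro u hu v hv huv
    rcases hbip u v huv with h | h
    · exact Finset.disjoint_left.1 hdisj hv h.2
    · exact Finset.disjoint_left.1 hdisj hu h.1
  apply le_antisymm
  · rw [le_sub_comm]
    refine Finset.sup'_le _ _ fun S hS => ?_
    rw [Finset.mem_powerset] at hS
    have hcov := hM.card_le_of_cover
      ((A \ S) ∪ (Set.toFinite {v : V | ∃ u ∈ S, G.Adj u v}).toFinset) (by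
        have key : ∀ u v, G.Adj u v → u ∈ A →
            ∃ w ∈ (A \ S) ∪ (Set.toFinite {v : V | ∃ u ∈ S, G.Adj u v}).toFinset,
              w ∈ s(u, v) := by
          intro u v huv hu
          by_cases huS : u ∈ S
          · exact ⟨v, Finset.mem_union_right _ (by simpa using ⟨u, huS, huv⟩), by simp⟩
          · exact ⟨u, Finset.mem_union_left _ (Finset.mem_sdiff.2 ⟨hu, huS⟩), by simp⟩
        intro e he
        induction e using Sym2.ind with
        | _ u v =>
          rcases hbip u v he with h | h
          · exact key u v he h.1
          · rw [Sym2.eq_swap]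
            exact key v u (G.adj_symm he) h.2)
    have hun := hcov.trans (Finset.card_union_le _ _)
    rw [← Set.ncard_eq_toFinset_card] at hun
    have hsd := Finset.card_sdiff_add_card_eq_card hS
    simp only [hφ]
    omega
  · have hle : ∀ S ⊆ A, φ S ≤ A.powerset.sup' ⟨∅, Finset.empty_mem_powerset A⟩ φ :=
      fun S hS => Finset.le_sup' φ (Finset.mem_powerset.2 hS)
    have hnonneg : 0 ≤ A.powerset.sup' ⟨∅, Finset.empty_mem_powerset A⟩ φ := by
      simpa [hφ] using hle ∅ (Finset.empty_subset A)
    obtain ⟨d, hd⟩ := Int.eq_ofNat_of_zero_le hnonneg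
    rw [hd] at hle ⊢
    obtain ⟨s, hs, hcard⟩ := exists_isMatchingFinset_of_card_le G A hAA d (by
      intro S hS
      have hSd := hle S hS
      simp only [hφ] at hSd
      omega)
    have hsM := hmax s hs
    omega
end

section
/- (Gallai–Edmonds, part (a)) Let G be a finite simple graph, let D(G) be the set of vertices v of G such that some maximum matching of G does not cover v. Then every connected component of the subgraph of G induced by D(G) is factor-critical, i.e., for every vertex v of such a component, deleting v from the component leaves a graph with a perfect matching. -/
/-- `s` is a maximum matching of `G`: a matching of maximum cardinality. -/
def IsMaximumMatchingFinset {V : Type*} (G : SimpleGraph V) (s : Finset (Sym2 V)) : Prop :=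
  IsMatchingFinset G s ∧ ∀ t : Finset (Sym2 V), IsMatchingFinset G t → t.card ≤ s.card

/-- `D(G)`: the set of vertices missed by at least one maximum matching of `G`. -/
def gallaiD {V : Type*} (G : SimpleGraph V) : Set V :=
  {v | ∃ s : Finset (Sym2 V), IsMaximumMatchingFinset G s ∧ ∀ e ∈ s, v ∉ e}

/-- `H` has a perfect matching: a matching covering every vertex of `H`. -/
def HasPerfectMatchingF {W : Type*} (H : SimpleGraph W) : Prop :=
  ∃ s : Finset (Sym2 W), IsMatchingFinset H s ∧ ∀ v : W, ∃ e ∈ s, v ∈ e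

open Function

theorem exists_alternating_orbit {V : Type*} [Finite V] {f g : V → V} (hf : Involutive f)
    (hg : Involutive g) {x : V} (hgx : g x = x) (hfx : f x ≠ x) :
    ∃ (O : Set V) (y : V), x ∈ O ∧ y ∈ O ∧ y ≠ x ∧ (∀ z ∈ O, f z ∈ O) ∧ (∀ z ∈ O, g z ∈ O) ∧
      ((∀ z ∈ O, (f z = z ↔ z = y) ∧ (g z = z ↔ z = x)) ∨
        (∀ z ∈ O, f z ≠ z ∧ (g z = z ↔ z = x ∨ z = y))) := by
  let S : Equiv.Perm V := hf.toPerm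
  let T : Equiv.Perm V := hg.toPerm
  let p : ℤ → V := fun k => ((S * T) ^ k) x
  have hS : S⁻¹ = S := rfl
  have hT : T⁻¹ = T := rfl
  have hgp : ∀ k, g (p k) = p (-k) := by
    intro k
    have h : T * (S * T) ^ k * T⁻¹ = (S * T) ^ (-k) := by
      rw [← conj_zpow, zpow_neg, ← inv_zpow, mul_inv_rev, hS, hT]
      congr 1
      rw [mul_assoc, mul_assoc]
      nth_rewrite 3 [← hT]
      simp
    have hTx : T⁻¹ x = x := hgx
    calc g (p k) = (T * (S * T) ^ k * T⁻¹) x := by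
          change _ = T (((S * T) ^ k) (T⁻¹ x))
          rw [hTx]
          rfl
      _ = p (-k) := by rw [h]
  have hfp : ∀ k, f (p k) = p (1 - k) := by
    intro k
    have h : p (1 - k) = (S * T) (p (-k)) := by
      change ((S * T) ^ (1 - k)) x = _
      rw [sub_eq_add_neg, zpow_add, zpow_one]
      rfl
    rw [h, ← hgp]
    exact congrArg f (hg _).symm
  obtain ⟨n, hn, hp⟩ : ∃ n : ℕ, 0 < n ∧ ∀ i j, p i = p j ↔ (n : ℤ) ∣ i - j := by
    refine ⟨minimalPeriod (fun z => (S * T) • z) x, ?_, fun i j => ?_⟩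
    · exact minimalPeriod_pos_of_mem_periodicPts
        ((S * T).injective.mem_periodicPts x)
    · rw [← MulAction.zpow_smul_eq_iff_minimalPeriod_dvd, sub_eq_neg_add, zpow_add, mul_smul,
        zpow_neg, inv_smul_eq_iff]
      rfl
  have hp0 : p 0 = x := by simp [p]
  obtain ⟨m, hm⟩ := Nat.even_or_odd' n
  refine ⟨Set.range p, if n = 2 * m then p m else p (m + 1), ⟨0, hp0⟩, ?_, ?_, ?_, ?_, ?_⟩
  · split_ifs <;> simp
  · rw [← hp0]
    split_ifs
    · rw [Ne, hp]
      rintro ⟨c, hc⟩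
      rcases hm with rfl | rfl
      · push_cast at hc
        have : (m : ℤ) * (2 * c - 1) = 0 := by linarith
        rcases mul_eq_zero.1 this with h | h <;> omega
      · omega
    · intro h
      apply hfx
      rw [← hp0, ← h, hfp, hp]
      exact ⟨-1, by omega⟩
  · rintro _ ⟨k, rfl⟩
    exact ⟨_, (hfp k).symm⟩
  · rintro _ ⟨k, rfl⟩
    exact ⟨_, (hgp k).symm⟩
  · rcases hm with rfl | rfl
    · right
      rintro _ ⟨k, rfl⟩
      rw [hfp, hgp, if_pos rfl, ← hp0, Ne, hp, hp, hp, hp]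
      push_cast
      refine ⟨?_, ?_⟩
      · rintro ⟨c, hc⟩
        have : 1 = 2 * (m * c + k) := by linarith
        omega
      · constructor
        · rintro ⟨c, hc⟩
          have hk : k = - (m * c) := by linarith
          subst hk
          obtain ⟨d, rfl | rfl⟩ := Int.even_or_odd' c
          · exact Or.inl ⟨-d, by ring⟩
          · exact Or.inr ⟨-d - 1, by ring⟩
        · rintro (⟨c, hc⟩ | ⟨c, hc⟩)
          · exact ⟨-2 * c, by linarith⟩
          · exact ⟨-2 * c - 1, by linarith⟩
    · left
      rintro _ ⟨k, rfl⟩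
      rw [hfp, hgp, if_neg (by omega), ← hp0, hp, hp, hp, hp]
      push_cast
      refine ⟨⟨?_, ?_⟩, ?_, ?_⟩
      · rintro ⟨c, hc⟩
        obtain ⟨d, rfl | rfl⟩ := Int.even_or_odd' c
        · have : 1 = 2 * ((2 * m + 1) * d + k) := by linarith
          omega
        · exact ⟨-d - 1, by linarith⟩
      · rintro ⟨c, hc⟩
        exact ⟨-2 * c - 1, by linarith⟩
      · rintro ⟨c, hc⟩
        obtain ⟨d, rfl | rfl⟩ := Int.even_or_odd' c
        · exact ⟨-d, by linarith⟩
        · have : 0 = 2 * ((2 * m + 1) * d + k + m) + 1 := by linarith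
          omega
      · rintro ⟨c, hc⟩
        exact ⟨-2 * c, by linarith⟩

/-- The involution `f` encodes a matching of `G`: each vertex it moves is sent to its partner,
and its fixed points are the uncovered vertices. -/
def IsMatchingInvolution {V : Type*} (G : SimpleGraph V) (f : V → V) : Prop :=
  Involutive f ∧ ∀ v, f v ≠ v → G.Adj v (f v)

/-- The involution `f` encodes a maximum matching of `G`. -/
def IsMaximumMatchingInvolution {V : Type*} (G : SimpleGraph V) (f : V → V) : Prop :=
  IsMatchingInvolution G f ∧
    ∀ g, IsMatchingInvolution G g → (fixedPoints f).ncard ≤ (fixedPoints g).ncard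

/-- Some maximum matching of `G`, encoded as an involution, does not cover `v`. -/
def IsMissable {V : Type*} (G : SimpleGraph V) (v : V) : Prop :=
  ∃ f, IsMaximumMatchingInvolution G f ∧ f v = v

/-- No maximum matching of `G` misses two distinct vertices `u` and `v`. -/
def NotBothMissed {V : Type*} (G : SimpleGraph V) (u v : V) : Prop :=
  ∀ f, IsMaximumMatchingInvolution G f → f u = u → f v = v → u = v

open Classical in
theorem IsMatchingInvolution.piecewise {V : Type*} {G : SimpleGraph V} {f g : V → V}
    (hf : IsMatchingInvolution G f) (hg : IsMatchingInvolution G g) {O : Set V}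
    (hfO : ∀ z ∈ O, f z ∈ O) (hgO : ∀ z ∈ O, g z ∈ O) :
    IsMatchingInvolution G (O.piecewise g f) := by
  have hfO' : ∀ z, z ∉ O → f z ∉ O := fun z hz h => hz (hf.1 z ▸ hfO _ h)
  refine ⟨fun z => ?_, fun z => ?_⟩
  · by_cases hz : z ∈ O
    · simp [hz, hgO z hz, hg.1 z]
    · simp [hz, hfO' z hz, hf.1 z]
  · by_cases hz : z ∈ O
    · simpa [hz] using hg.2 z
    · simpa [hz] using hf.2 z

theorem IsMatchingInvolution.exchange {V : Type*} [Finite V] {G : SimpleGraph V} {f g : V → V}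
    (hf : IsMatchingInvolution G f) (hg : IsMatchingInvolution G g) {x : V} (hgx : g x = x)
    (hfx : f x ≠ x) :
    (∃ y f', y ≠ x ∧ f y = y ∧ IsMatchingInvolution G f' ∧
      fixedPoints f' = insert x (fixedPoints f \ {y})) ∨
    (∃ y f' g', y ≠ x ∧ g y = y ∧ IsMatchingInvolution G f' ∧ IsMatchingInvolution G g' ∧
      f y ≠ y ∧ fixedPoints f' = insert x (insert y (fixedPoints f)) ∧
      fixedPoints g' = fixedPoints g \ {x, y}) := by
  classical
  obtain ⟨O, y, hxO, hyO, hyx, hfO, hgO, h | h⟩ := exists_alternating_orbit hf.1 hg.1 hgx hfx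
  · refine Or.inl ⟨y, O.piecewise g f, hyx, ((h y hyO).1).2 rfl, hf.piecewise hg hfO hgO, ?_⟩
    ext z
    by_cases hz : z ∈ O
    · have := h z hz
      simp only [mem_fixedPoints, IsFixedPt, Set.piecewise_eq_of_mem _ _ _ hz, Set.mem_insert_iff,
        Set.mem_sdiff, Set.mem_singleton_iff]
      tauto
    · have h1 : z ≠ x := by rintro rfl; exact hz hxO
      have h2 : z ≠ y := by rintro rfl; exact hz hyO
      simp [mem_fixedPoints, IsFixedPt, hz, h1, h2]
  · refine Or.inr ⟨y, O.piecewise g f, O.piecewise f g, hyx, ((h y hyO).2).2 (Or.inr rfl),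
      hf.piecewise hg hfO hgO, hg.piecewise hf hgO hfO, (h y hyO).1, ?_, ?_⟩
    all_goals
      ext z
      by_cases hz : z ∈ O
      · have := h z hz
        simp only [mem_fixedPoints, IsFixedPt, Set.piecewise_eq_of_mem _ _ _ hz,
          Set.mem_insert_iff, Set.mem_sdiff, Set.mem_singleton_iff]
        tauto
      · have h1 : z ≠ x := by rintro rfl; exact hz hxO
        have h2 : z ≠ y := by rintro rfl; exact hz hyO
        simp [mem_fixedPoints, IsFixedPt, hz, h1, h2]

theorem IsMatchingInvolution.exists_add_edge {V : Type*} {G : SimpleGraph V} {f : V → V}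
    (hf : IsMatchingInvolution G f) {u v : V} (huv : G.Adj u v) (hu : f u = u) (hv : f v = v) :
    ∃ f', IsMatchingInvolution G f' ∧ fixedPoints f' = fixedPoints f \ {u, v} := by
  classical
  have hne := huv.ne
  have hinj := hf.1.injective
  refine ⟨fun z => if z = u then v else if z = v then u else f z, ⟨fun z => ?_, fun z => ?_⟩, ?_⟩
  · have h1 : f z = u → z = u := fun h => hinj (h.trans hu.symm)
    have h2 : f z = v → z = v := fun h => hinj (h.trans hv.symm)
    have := hf.1 z
    grind
  · have := hf.2 z
    have := huv.symm
    grind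
  · ext z
    simp only [mem_fixedPoints, IsFixedPt, Set.mem_insert_iff, Set.mem_sdiff, Set.mem_singleton_iff]
    grind

theorem IsMatchingInvolution.exists_remove_edge {V : Type*} {G : SimpleGraph V} {f : V → V}
    (hf : IsMatchingInvolution G f) (a : V) :
    ∃ f', IsMatchingInvolution G f' ∧
      fixedPoints f' = insert a (insert (f a) (fixedPoints f)) := by
  classical
  refine ⟨fun z => if z = a then z else if z = f a then z else f z,
    ⟨fun z => ?_, fun z => ?_⟩, ?_⟩
  · have := hf.1 z
    have := hf.1 a
    grind
  · have := hf.2 z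
    grind
  · ext z
    simp only [mem_fixedPoints, IsFixedPt, Set.mem_insert_iff]
    grind

theorem ncard_fixedPoints_modEq {V : Type*} [Finite V] {f g : V → V} (hf : Involutive f)
    (hg : Involutive g) : (fixedPoints f).ncard ≡ (fixedPoints g).ncard [MOD 2] := by
  classical
  have := Fintype.ofFinite V
  have key : ∀ {h : V → V}, Involutive h →
      Fintype.card V ≡ (fixedPoints h).ncard [MOD 2] := by
    intro h hh
    rw [← Nat.card_coe_set_eq, Nat.card_eq_fintype_card]
    refine Equiv.Perm.card_fixedPoints_modEq (f := h) (p := 2) (n := 1) ?_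
    exact funext hh
  exact (key hf).symm.trans (key hg)

theorem exists_isMaximumMatchingInvolution {V : Type*} (G : SimpleGraph V) :
    ∃ f, IsMaximumMatchingInvolution G f := by
  have hne : {f | IsMatchingInvolution G f}.Nonempty :=
    ⟨id, fun _ => rfl, fun v h => absurd rfl h⟩
  refine ⟨argminOn (fun f : V → V => (fixedPoints f).ncard) {f | IsMatchingInvolution G f} hne,
    argminOn_mem _ _ hne, fun g hg => ?_⟩
  exact argminOn_le (fun f : V → V => (fixedPoints f).ncard) _ hg

theorem IsMaximumMatchingInvolution.of_ncard_le {V : Type*} {G : SimpleGraph V} {f g : V → V}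
    (hf : IsMaximumMatchingInvolution G f) (hg : IsMatchingInvolution G g)
    (h : (fixedPoints g).ncard ≤ (fixedPoints f).ncard) : IsMaximumMatchingInvolution G g :=
  ⟨hg, fun k hk => h.trans (hf.2 k hk)⟩

theorem IsMaximumMatchingInvolution.not_sdiff_pair {V : Type*} [Finite V] {G : SimpleGraph V}
    {f g : V → V} (hf : IsMaximumMatchingInvolution G f) (hg : IsMatchingInvolution G g)
    {x y : V} (hx : f x = x) : fixedPoints g ≠ fixedPoints f \ {x, y} := by
  intro h
  have hlt : (fixedPoints g).ncard < (fixedPoints f).ncard := by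
    refine Set.ncard_lt_ncard ?_ (Set.toFinite _)
    rw [h, Set.ssubset_iff_exists]
    exact ⟨Set.sdiff_subset, x, hx, by simp⟩
  exact absurd (hf.2 g hg) (by omega)

theorem NotBothMissed.of_adj {V : Type*} [Finite V] {G : SimpleGraph V} {u v : V}
    (h : G.Adj u v) : NotBothMissed G u v := by
  intro f hf hu hv
  obtain ⟨f', hf', hfix⟩ := hf.1.exists_add_edge h hu hv
  exact absurd hfix (hf.not_sdiff_pair hf' hu)

theorem NotBothMissed.trans {V : Type*} [Finite V] {G : SimpleGraph V} {u v w : V}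
    (huv : NotBothMissed G u v) (hv : IsMissable G v) (hvw : NotBothMissed G v w) :
    NotBothMissed G u w := by
  intro f hf hu hw
  by_cases hfv : f v = v
  · exact (huv f hf hu hfv).trans (hvw f hf hfv hw)
  obtain ⟨g, hg, hgv⟩ := hv
  obtain ⟨y, f', hyv, hfy, hf', hfix⟩ | ⟨y, f', g', -, -, -, hg', -, -, hfix⟩ :=
    hf.1.exchange hg.1 hgv hfv
  · have hmax : IsMaximumMatchingInvolution G f' :=
      hf.of_ncard_le hf' (by rw [hfix, Set.ncard_exchange (s := fixedPoints f) hfv hfy])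
    have hmem : ∀ z, f' z = z ↔ z ∈ insert v (fixedPoints f \ {y}) := fun z => by
      rw [← hfix]; rfl
    have hv' : f' v = v := (hmem v).2 (Set.mem_insert _ _)
    have hz : ∀ z, f z = z → z ≠ y → f' z = z := fun z h1 h2 => (hmem z).2 (Or.inr ⟨h1, h2⟩)
    by_cases huy : u = y
    · by_cases hwy : w = y
      · rw [huy, hwy]
      · exact absurd (hvw f' hmax hv' (hz w hw hwy) ▸ hw) hfv
    · exact absurd (huv f' hmax (hz u hu huy) hv' ▸ hu) hfv
  · exact absurd hfix (hg.not_sdiff_pair hg' hgv)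

theorem isMatchingInvolution_deleteIncidenceSet {V : Type*} {G : SimpleGraph V} {a : V}
    {f : V → V} :
    IsMatchingInvolution (G.deleteIncidenceSet a) f ↔ IsMatchingInvolution G f ∧ f a = a := by
  simp only [IsMatchingInvolution, SimpleGraph.deleteIncidenceSet_adj]
  constructor
  · rintro ⟨h1, h2⟩
    refine ⟨⟨h1, fun v hv => (h2 v hv).1⟩, ?_⟩
    by_contra h
    exact (h2 a h).2.1 rfl
  · rintro ⟨⟨h1, h2⟩, h3⟩
    refine ⟨h1, fun v hv => ⟨h2 v hv, ?_, ?_⟩⟩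
    · rintro rfl
      exact hv h3
    · intro h
      apply hv
      have := h1 v
      rw [h, h3] at this
      rw [h, this]

/-- The stability lemma of Gallai–Edmonds theory. -/
theorem isMissable_deleteIncidenceSet_iff {V : Type*} [Finite V] {G : SimpleGraph V} {a u : V}
    (ha : ¬ IsMissable G a) (hu : IsMissable G u) (hau : G.Adj a u) (x : V) :
    IsMissable (G.deleteIncidenceSet a) x ↔ IsMissable G x ∨ x = a := by
  constructor
  · rintro ⟨g, hg, hgx⟩
    by_contra! hx
    obtain ⟨hx, hxa⟩ := hx
    obtain ⟨hgG, hga⟩ := isMatchingInvolution_deleteIncidenceSet.1 hg.1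
    obtain ⟨f, hf, hfu⟩ := hu
    have hfx : f x ≠ x := fun h => hx ⟨f, hf, h⟩
    obtain ⟨y, f', hyx, hfy, hf', hfix⟩ | ⟨y, f', g', hyx, hgy, hf', hg', hfy, hfix, hgfix⟩ :=
      hf.1.exchange hgG hgx hfx
    · refine hx ⟨f', hf.of_ncard_le hf' (by rw [hfix, Set.ncard_exchange (s := fixedPoints f) hfx hfy]), ?_⟩
      change x ∈ fixedPoints f'
      simp [hfix]
    · by_cases hya : y = a
      · subst hya
        have hxu : x ≠ u := by rintro rfl; exact hfx hfu
        have hyu := hau.ne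
        have hmem : ∀ z, z ∈ insert x (insert y (fixedPoints f)) → f' z = z := fun z hz => by
          rw [← hfix] at hz; exact hz
        obtain ⟨k, hk, hkfix⟩ := hf'.exists_add_edge hau (hmem y (by simp))
          (hmem u (Or.inr (Or.inr hfu)))
        have hk' : fixedPoints k = insert x (fixedPoints f \ {u}) := by
          rw [hkfix, hfix]
          ext z
          simp only [Set.mem_insert_iff, Set.mem_sdiff, Set.mem_singleton_iff, mem_fixedPoints,
            IsFixedPt]
          grind
        refine hx ⟨k, hf.of_ncard_le hk (by rw [hk', Set.ncard_exchange (s := fixedPoints f) hfx hfu]), ?_⟩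
        change x ∈ fixedPoints k
        simp [hk']
      · refine hg.not_sdiff_pair (isMatchingInvolution_deleteIncidenceSet.2 ⟨hg', ?_⟩) hgx hgfix
        change a ∈ fixedPoints g'
        rw [hgfix]
        exact ⟨hga, by simp [Ne.symm hxa, Ne.symm hya]⟩
  · rintro (⟨f, hf, hfx⟩ | rfl)
    · have hfa : f a ≠ a := fun h => ha ⟨f, hf, h⟩
      obtain ⟨f', hf', hfix⟩ := hf.1.exists_remove_edge a
      have hmem : ∀ z, z ∈ insert a (insert (f a) (fixedPoints f)) → f' z = z := fun z hz => by
        rw [← hfix] at hz; exact hz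
      refine ⟨f', ⟨isMatchingInvolution_deleteIncidenceSet.2 ⟨hf', hmem a (by simp)⟩,
        fun g hg => ?_⟩, hmem x (Or.inr (Or.inr hfx))⟩
      obtain ⟨hg, hga⟩ := isMatchingInvolution_deleteIncidenceSet.1 hg
      have hlt : (fixedPoints f).ncard < (fixedPoints g).ncard := by
        by_contra! h
        exact ha ⟨g, hf.of_ncard_le hg h, hga⟩
      have hmod := ncard_fixedPoints_modEq hf.1.1 hg.1
      have hle : (fixedPoints f').ncard ≤ (fixedPoints f).ncard + 1 + 1 := by
        rw [hfix]
        exact (Set.ncard_insert_le _ _).trans (Nat.succ_le_succ (Set.ncard_insert_le _ _))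
      unfold Nat.ModEq at hmod
      omega
    · obtain ⟨f, hf⟩ := exists_isMaximumMatchingInvolution (G.deleteIncidenceSet x)
      exact ⟨f, hf, (isMatchingInvolution_deleteIncidenceSet.1 hf.1).2⟩

theorem exists_delete_isMissable_iff {V : Type*} [Finite V] (G : SimpleGraph V) (S : Set V)
    (hS : ∀ a ∈ S, ¬ IsMissable G a ∧ ∃ u, IsMissable G u ∧ G.Adj a u) :
    ∃ H : SimpleGraph V, (∀ u v, H.Adj u v ↔ G.Adj u v ∧ u ∉ S ∧ v ∉ S) ∧
      ∀ v, IsMissable H v ↔ IsMissable G v ∨ v ∈ S := by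
  induction S, S.toFinite using Set.Finite.induction_on with
  | empty => exact ⟨G, by simp, by simp⟩
  | @insert a S haS _ ih =>
    obtain ⟨H, hadj, hmiss⟩ := ih fun b hb => hS b (Or.inr hb)
    obtain ⟨ha, u, hu, hau⟩ := hS a (Or.inl rfl)
    have huS : u ∉ S := fun h => (hS u (Or.inr h)).1 hu
    have key := isMissable_deleteIncidenceSet_iff (G := H) (a := a) (u := u)
      (by rw [hmiss]; tauto) ((hmiss u).2 (Or.inl hu)) ((hadj a u).2 ⟨hau, haS, huS⟩)
    refine ⟨H.deleteIncidenceSet a, fun v w => ?_, fun v => ?_⟩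
    · simp only [SimpleGraph.deleteIncidenceSet_adj, hadj, Set.mem_insert_iff]
      tauto
    · rw [key, hmiss, Set.mem_insert_iff]
      tauto

/-- A set of edges and an involution encode the same matching. -/
def EncodesMatching {V : Type*} (s : Finset (Sym2 V)) (f : V → V) : Prop :=
  ∀ v w, s(v, w) ∈ s ↔ f v = w ∧ v ≠ w

theorem IsMatchingFinset.exists_encodes {V : Type*} {G : SimpleGraph V} {s : Finset (Sym2 V)}
    (hs : IsMatchingFinset G s) : ∃ f, IsMatchingInvolution G f ∧ EncodesMatching s f := by
  classical
  have huniq : ∀ v w w', s(v, w) ∈ s → s(v, w') ∈ s → w = w' := by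
    intro v w w' h h'
    by_contra hne
    exact hs.2 h h' (fun h => hne (Sym2.congr_right.1 h)) v (by simp) (by simp)
  let f : V → V := fun v => if h : ∃ w, s(v, w) ∈ s then h.choose else v
  have hf : ∀ v w, s(v, w) ∈ s → f v = w := by
    intro v w h
    have h' : ∃ w, s(v, w) ∈ s := ⟨w, h⟩
    simp only [f, dif_pos h']
    exact huniq v _ _ h'.choose_spec h
  have hf' : ∀ v, f v ≠ v → s(v, f v) ∈ s := by
    intro v hv
    by_cases h : ∃ w, s(v, w) ∈ s
    · obtain ⟨w, hw⟩ := h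
      rwa [hf v w hw]
    · simp [f, h] at hv
  refine ⟨f, ⟨fun v => ?_, fun v hv => hs.1 _ (hf' v hv)⟩, fun v w => ⟨fun h => ?_, ?_⟩⟩
  · by_cases hv : f v = v
    · rw [hv, hv]
    · exact hf _ _ (Sym2.eq_swap ▸ hf' v hv)
  · exact ⟨hf v w h, (show G.Adj v w from hs.1 _ h).ne⟩
  · rintro ⟨rfl, h⟩
    exact hf' v h.symm

theorem IsMatchingInvolution.exists_encodes {V : Type*} [Finite V] {G : SimpleGraph V} {f : V → V}
    (hf : IsMatchingInvolution G f) : ∃ s, IsMatchingFinset G s ∧ EncodesMatching s f := by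
  classical
  have := Fintype.ofFinite V
  have henc : EncodesMatching ((Finset.univ.filter fun v => f v ≠ v).image fun v => s(v, f v)) f := by
    intro v w
    simp only [Finset.mem_image, Finset.mem_filter, Finset.mem_univ, true_and, Sym2.eq_iff]
    constructor
    · rintro ⟨z, hz, ⟨rfl, rfl⟩ | ⟨rfl, rfl⟩⟩
      · exact ⟨rfl, hz.symm⟩
      · exact ⟨hf.1 _, hz⟩
    · rintro ⟨rfl, h⟩
      exact ⟨v, h.symm, Or.inl ⟨rfl, rfl⟩⟩
  refine ⟨_, ⟨fun e => ?_, fun e he e' he' hne v hv hv' => ?_⟩, henc⟩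
  · induction e with | _ v w =>
    rw [henc]
    rintro ⟨rfl, h⟩
    exact hf.2 v h.symm
  · obtain ⟨w, rfl⟩ := hv
    obtain ⟨w', rfl⟩ := hv'
    rw [Finset.mem_coe, henc] at he he'
    exact hne (by rw [← he.1, ← he'.1])

theorem EncodesMatching.apply_eq_self_iff {V : Type*} {s : Finset (Sym2 V)} {f : V → V}
    (h : EncodesMatching s f) (v : V) : f v = v ↔ ∀ e ∈ s, v ∉ e := by
  constructor
  · rintro hv _ he ⟨w, rfl⟩
    rw [h] at he
    exact he.2 (hv ▸ he.1)
  · intro hv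
    by_contra hne
    exact hv s(v, f v) ((h _ _).2 ⟨rfl, Ne.symm hne⟩) (by simp)

theorem EncodesMatching.two_mul_card_add_ncard {V : Type*} [Finite V] {G : SimpleGraph V}
    {s : Finset (Sym2 V)} {f : V → V} (h : EncodesMatching s f) (hs : IsMatchingFinset G s) :
    2 * s.card + (fixedPoints f).ncard = Nat.card V := by
  classical
  have hcov : (fixedPoints f)ᶜ = (s.biUnion Sym2.toFinset : Finset V) := by
    ext v
    simp [mem_fixedPoints, IsFixedPt, h.apply_eq_self_iff]
  rw [← Set.ncard_add_ncard_compl (fixedPoints f), hcov, Set.ncard_coe_finset,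
    Finset.card_biUnion, Finset.sum_const_nat (m := 2)]
  · ring
  · exact fun e he => Sym2.card_toFinset_of_not_isDiag e (G.not_isDiag_of_mem_edgeSet (hs.1 e he))
  · intro e he e' he' hne
    change Disjoint _ _
    rw [Finset.disjoint_left]
    simpa using hs.2 he he' hne

theorem mem_gallaiD_iff {V : Type*} [Finite V] {G : SimpleGraph V} {v : V} :
    v ∈ gallaiD G ↔ IsMissable G v := by
  constructor
  · rintro ⟨s, ⟨hs, hmax⟩, hv⟩
    obtain ⟨f, hf, hsf⟩ := hs.exists_encodes
    refine ⟨f, ⟨hf, fun g hg => ?_⟩, (hsf.apply_eq_self_iff v).2 hv⟩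
    obtain ⟨t, ht, htg⟩ := hg.exists_encodes
    have := hmax t ht
    have := hsf.two_mul_card_add_ncard hs
    have := htg.two_mul_card_add_ncard ht
    omega
  · rintro ⟨f, ⟨hf, hmax⟩, hv⟩
    obtain ⟨s, hs, hsf⟩ := hf.exists_encodes
    refine ⟨s, ⟨hs, fun t ht => ?_⟩, (hsf.apply_eq_self_iff v).1 hv⟩
    obtain ⟨g, hg, htg⟩ := ht.exists_encodes
    have := hmax g hg
    have := hsf.two_mul_card_add_ncard hs
    have := htg.two_mul_card_add_ncard ht
    omega

theorem hasPerfectMatchingF_of_involution {W : Type*} [Finite W] {H : SimpleGraph W} {f : W → W}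
    (hf : IsMatchingInvolution H f) (hfix : ∀ v, f v ≠ v) : HasPerfectMatchingF H := by
  obtain ⟨s, hs, hsf⟩ := hf.exists_encodes
  refine ⟨s, hs, fun v => ?_⟩
  by_contra! h
  exact hfix v ((hsf.apply_eq_self_iff v).2 h)

/-- Gallai–Edmonds (a): every connected component of the subgraph induced by `D(G)` is
factor-critical, i.e. deleting any of its vertices leaves a graph with a perfect matching. -/
theorem gallai_edmonds_a {V : Type*} [Fintype V] (G : SimpleGraph V)
    (c : (G.induce (gallaiD G)).ConnectedComponent)
    (v : gallaiD G) (hv : v ∈ c.supp) :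
    HasPerfectMatchingF ((G.induce (gallaiD G)).induce (c.supp \ {v})) := by
  obtain ⟨H, hadj, hmiss⟩ := exists_delete_isMissable_iff G
    {a | ¬ IsMissable G a ∧ ∃ u, IsMissable G u ∧ G.Adj a u} fun a ha => ha
  have hD : ∀ w : gallaiD G, IsMissable G w := fun w => mem_gallaiD_iff.1 w.2
  have hDH : ∀ w : gallaiD G, IsMissable H w := fun w => (hmiss w).2 (Or.inl (hD w))
  have hrel : ∀ w, (G.induce (gallaiD G)).Reachable v w → NotBothMissed H v w := by
    intro w hw
    rw [SimpleGraph.reachable_iff_reflTransGen] at hw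
    induction hw with
    | refl => exact fun _ _ _ _ => rfl
    | @tail b d _ hbd ih =>
      refine ih.trans (hDH b) (.of_adj ((hadj _ _).2 ⟨hbd, ?_, ?_⟩))
      · exact fun h => h.1 (hD b)
      · exact fun h => h.1 (hD d)
  obtain ⟨f, hf, hfv⟩ := hDH v
  have hne : ∀ w : gallaiD G, w ∈ c.supp → w ≠ v → f w ≠ w := by
    intro w hw hwv hfw
    refine hwv (Subtype.ext (hrel w ?_ f hf hfv hfw).symm)
    exact SimpleGraph.ConnectedComponent.exact (hv.trans hw.symm)
  have hmem : ∀ w : gallaiD G, w ∈ c.supp → w ≠ v → f w ∈ gallaiD G := by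
    intro w hw hwv
    by_contra h
    rw [mem_gallaiD_iff] at h
    have := (hadj _ _).1 (hf.1.2 w (hne w hw hwv))
    exact this.2.2 ⟨h, w, hD w, this.1.symm⟩
  have hGadj : ∀ w : gallaiD G, w ∈ c.supp → w ≠ v → G.Adj w (f w) := fun w hw hwv =>
    ((hadj _ _).1 (hf.1.2 w (hne w hw hwv))).1
  let F : (c.supp \ {v} : Set (gallaiD G)) → (c.supp \ {v} : Set (gallaiD G)) := fun w =>
    ⟨⟨f w, hmem w w.2.1 w.2.2⟩, by
      have hw : (G.induce (gallaiD G)).Adj w ⟨f w, hmem w w.2.1 w.2.2⟩ :=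
        hGadj w w.2.1 w.2.2
      exact (SimpleGraph.ConnectedComponent.mem_supp_congr_adj c hw).1 w.2.1, by
      intro h
      have h' : f w = v := congrArg Subtype.val h
      refine w.2.2 (Subtype.ext ?_)
      rw [← hf.1.1 w, h', hfv]⟩
  refine hasPerfectMatchingF_of_involution (f := F)
    ⟨fun w => Subtype.ext (Subtype.ext (hf.1.1 w)), fun w _ => hGadj w w.2.1 w.2.2⟩ ?_
  exact fun w h => hne w w.2.1 w.2.2 (congrArg (fun z => (z.1.1 : V)) h)
end

section
/- (Gallai–Edmonds, part (b)) Let G be a finite simple graph, let D(G) be the set of vertices v of G such that some maximum matching of G does not cover v, let A(G) be the set of vertices in V(G) \ D(G) adjacent to at least one vertex of D(G), and let C(G) = V(G) \ (D(G) ∪ A(G)). Then the subgraph of G induced by C(G) has a perfect matching. -/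
/-- `A(G)`: the set of vertices outside `D(G)` adjacent to at least one vertex of `D(G)`. -/
def gallaiA {V : Type*} (G : SimpleGraph V) : Set V :=
  {v | v ∉ gallaiD G ∧ ∃ u ∈ gallaiD G, G.Adj v u}

/-- `C(G) = V(G) \ (D(G) ∪ A(G))`. -/
def gallaiC {V : Type*} (G : SimpleGraph V) : Set V :=
  {v | v ∉ gallaiD G ∧ v ∉ gallaiA G}

theorem IsMatchingFinset.eq_of_mem {V : Type*} {G : SimpleGraph V} {s : Finset (Sym2 V)}
    (hs : IsMatchingFinset G s) {e f : Sym2 V} (he : e ∈ s) (hf : f ∈ s) {v : V}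
    (hve : v ∈ e) (hvf : v ∈ f) : e = f := by
  by_contra h
  exact hs.2 he hf h v hve hvf

theorem IsMatchingFinset.subset {V : Type*} {G : SimpleGraph V} {s t : Finset (Sym2 V)}
    (hs : IsMatchingFinset G s) (hts : t ⊆ s) : IsMatchingFinset G t :=
  ⟨fun e he => hs.1 e (hts he), fun _ he _ hf => hs.2 (hts he) (hts hf)⟩

theorem IsMatchingFinset.insert {V : Type*} [DecidableEq V] {G : SimpleGraph V}
    {s : Finset (Sym2 V)} (hs : IsMatchingFinset G s) {x y : V} (hxy : G.Adj x y)
    (hx : ∀ e ∈ s, x ∉ e) (hy : ∀ e ∈ s, y ∉ e) :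
    IsMatchingFinset G (insert s(x, y) s) := by
  refine ⟨fun e he => ?_, fun e he f hf hef v hve hvf => ?_⟩
  · rcases Finset.mem_insert.1 he with rfl | he
    · exact hxy
    · exact hs.1 e he
  · rw [Finset.mem_coe, Finset.mem_insert] at he hf
    rcases he with rfl | he <;> rcases hf with rfl | hf
    · exact hef rfl
    · rcases Sym2.mem_iff.1 hve with rfl | rfl
      exacts [hx f hf hvf, hy f hf hvf]
    · rcases Sym2.mem_iff.1 hvf with rfl | rfl
      exacts [hx e he hve, hy e he hve]
    · exact hs.2 he hf hef v hve hvf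

theorem exists_isMaximumMatchingFinset {V : Type*} [Finite V] (G : SimpleGraph V) :
    ∃ s : Finset (Sym2 V), IsMaximumMatchingFinset G s := by
  classical
  have := Fintype.ofFinite V
  obtain ⟨s, hs, hmax⟩ := Finset.exists_max_image
    (Finset.univ.filter fun s : Finset (Sym2 V) => IsMatchingFinset G s) Finset.card
    ⟨∅, Finset.mem_filter.2 ⟨Finset.mem_univ _, by simp [IsMatchingFinset]⟩⟩
  exact ⟨s, (Finset.mem_filter.1 hs).2,
    fun t ht => hmax t (Finset.mem_filter.2 ⟨Finset.mem_univ t, ht⟩)⟩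

/-- Both ends of an edge cannot be missed by a maximum matching. -/
theorem IsMaximumMatchingFinset.exists_mem_of_adj {V : Type*} {G : SimpleGraph V}
    {s : Finset (Sym2 V)} (hs : IsMaximumMatchingFinset G s) {x y : V} (hxy : G.Adj x y)
    (hx : ∀ e ∈ s, x ∉ e) : ∃ e ∈ s, y ∈ e := by
  classical
  by_contra! hy
  have hcard := hs.2 _ (hs.1.insert hxy hx hy)
  rw [Finset.card_insert_of_notMem fun h => hx _ h (Sym2.mem_mk_left x y)] at hcard
  omega

/-- Replacing the edge `pq` of a maximum matching by `qz`, where `z` is missed, yields a maximum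
matching that misses `p`. -/
theorem IsMaximumMatchingFinset.swap {V : Type*} [DecidableEq V] {G : SimpleGraph V}
    {s : Finset (Sym2 V)} (hs : IsMaximumMatchingFinset G s) {p q z : V} (hpq : s(p, q) ∈ s)
    (hqz : G.Adj q z) (hz : ∀ e ∈ s, z ∉ e) :
    IsMaximumMatchingFinset G (insert s(q, z) (s.erase s(p, q))) ∧
      ∀ e ∈ insert s(q, z) (s.erase s(p, q)), p ∉ e := by
  have missed {v : V} (hv : v ∈ s(p, q)) : ∀ e ∈ s.erase s(p, q), v ∉ e := fun e he hve =>
    (Finset.mem_erase.1 he).1 (hs.1.eq_of_mem (Finset.mem_erase.1 he).2 hpq hve hv)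
  have hz' : ∀ e ∈ s.erase s(p, q), z ∉ e := fun e he => hz e (Finset.mem_erase.1 he).2
  refine ⟨⟨(hs.1.subset (Finset.erase_subset _ _)).insert hqz
    (missed (Sym2.mem_mk_right p q)) hz', fun t ht => ?_⟩, fun e he hpe => ?_⟩
  · rw [Finset.card_insert_of_notMem fun h => hz' _ h (Sym2.mem_mk_right q z),
      Finset.card_erase_add_one hpq]
    exact hs.2 t ht
  · rcases Finset.mem_insert.1 he with rfl | he
    · rcases Sym2.mem_iff.1 hpe with rfl | rfl
      · exact (hs.1.1 _ hpq).ne rfl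
      · exact hz _ hpq (Sym2.mem_mk_left _ _)
    · exact missed (Sym2.mem_mk_left p q) e he hpe

/-- If `d` is missed by some maximum matching `t`, then any maximum matching `s` can be changed
into one that misses `d` while keeping the edges of `s ∩ t` and an edge of `s` avoiding `D(G)`. -/
theorem IsMaximumMatchingFinset.exists_missing_of_inter_subset {V : Type*} [DecidableEq V]
    {G : SimpleGraph V} {s t : Finset (Sym2 V)} (hs : IsMaximumMatchingFinset G s)
    (ht : IsMaximumMatchingFinset G t) {d : V} (hd : ∀ e ∈ t, d ∉ e) {g : Sym2 V} (hg : g ∈ s)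
    (hgD : ∀ v ∈ g, v ∉ gallaiD G) :
    ∃ r, IsMaximumMatchingFinset G r ∧ (∀ e ∈ r, d ∉ e) ∧ g ∈ r ∧ s ∩ t ⊆ r := by
  induction hn : (s \ t).card using Nat.strong_induction_on generalizing t d with
  | _ n ih =>
    by_cases hsd : ∀ e ∈ s, d ∉ e
    · exact ⟨s, hs, hsd, hg, Finset.inter_subset_left⟩
    push Not at hsd
    obtain ⟨f, hf, hdf⟩ := hsd
    obtain ⟨x, rfl⟩ := hdf
    have hdx : G.Adj d x := hs.1.1 _ hf
    obtain ⟨f', hf', hxf'⟩ := ht.exists_mem_of_adj hdx hd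
    obtain ⟨y, rfl⟩ := hxf'
    have hxy : G.Adj x y := ht.1.1 _ hf'
    have hdxt : s(d, x) ∉ t := fun h => hd _ h (Sym2.mem_mk_left d x)
    have hyd : y ≠ d := by
      rintro rfl
      exact hd _ hf' (Sym2.mem_mk_right x y)
    have hxys : s(x, y) ∉ s := fun h => by
      have := hs.1.eq_of_mem h hf (Sym2.mem_mk_left x y) (Sym2.mem_mk_right d x)
      have hy : y ∈ s(d, x) := this ▸ Sym2.mem_mk_right x y
      rcases Sym2.mem_iff.1 hy with rfl | rfl
      exacts [hyd rfl, hxy.ne rfl]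
    rw [Sym2.eq_swap] at hf'
    obtain ⟨ht', hy⟩ := ht.swap hf' hdx.symm hd
    set t' := insert s(x, d) (t.erase s(y, x)) with ht'_def
    have hlt : (s \ t').card < n := by
      rw [← hn]
      refine Finset.card_lt_card (Finset.ssubset_iff_of_subset ?_ |>.2
        ⟨s(d, x), Finset.mem_sdiff.2 ⟨hf, hdxt⟩, ?_⟩)
      · intro e he
        obtain ⟨hes, het⟩ := Finset.mem_sdiff.1 he
        refine Finset.mem_sdiff.2 ⟨hes, fun h => het ?_⟩
        refine Finset.mem_insert_of_mem (Finset.mem_erase.2 ⟨?_, h⟩)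
        rintro rfl
        exact hxys (Sym2.eq_swap ▸ hes)
      · simp [ht'_def, Sym2.eq_swap]
    obtain ⟨r, hr, hyr, hgr, hsub⟩ := ih _ hlt ht' hy rfl
    have hdxr : s(d, x) ∈ r :=
      hsub (Finset.mem_inter.2 ⟨hf, Finset.mem_insert.2 (.inl Sym2.eq_swap)⟩)
    obtain ⟨hr', hdr'⟩ := hr.swap hdxr hxy hyr
    refine ⟨_, hr', hdr', Finset.mem_insert_of_mem (Finset.mem_erase.2 ⟨?_, hgr⟩), ?_⟩
    · rintro rfl
      exact hgD d (Sym2.mem_mk_left d x) ⟨t, ht, hd⟩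
    · intro e he
      obtain ⟨hes, het⟩ := Finset.mem_inter.1 he
      refine Finset.mem_insert_of_mem (Finset.mem_erase.2 ⟨?_, hsub (Finset.mem_inter.2
        ⟨hes, Finset.mem_insert_of_mem (Finset.mem_erase.2 ⟨?_, het⟩)⟩)⟩)
      · rintro rfl
        exact hdxt het
      · rintro rfl
        exact hxys (Sym2.eq_swap ▸ hes)

/-- Every maximum matching matches `A(G)` into `D(G)`. -/
theorem IsMaximumMatchingFinset.mem_gallaiD_of_mem_gallaiA {V : Type*} {G : SimpleGraph V}
    {s : Finset (Sym2 V)} (hs : IsMaximumMatchingFinset G s) {a w : V} (ha : a ∈ gallaiA G)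
    (haw : s(a, w) ∈ s) : w ∈ gallaiD G := by
  classical
  by_contra hw
  obtain ⟨haD, d, ⟨t, ht, hd⟩, had⟩ := ha
  obtain ⟨r, hr, hdr, hawr, -⟩ := hs.exists_missing_of_inter_subset ht hd haw (by
    intro v hv
    rcases Sym2.mem_iff.1 hv with rfl | rfl <;> assumption)
  rw [Sym2.eq_swap] at hawr
  exact hw ⟨_, hr.swap hawr had hdr⟩

/-- Every maximum matching matches `C(G)` into `C(G)`. -/
theorem IsMaximumMatchingFinset.mem_gallaiC_of_mem_gallaiC {V : Type*} {G : SimpleGraph V}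
    {s : Finset (Sym2 V)} (hs : IsMaximumMatchingFinset G s) {v w : V} (hv : v ∈ gallaiC G)
    (hvw : s(v, w) ∈ s) : w ∈ gallaiC G :=
  ⟨fun hw => hv.2 ⟨hv.1, w, hw, hs.1.1 _ hvw⟩,
    fun hw => hv.1 (hs.mem_gallaiD_of_mem_gallaiA hw (Sym2.eq_swap ▸ hvw))⟩

/-- Gallai–Edmonds (b): the subgraph of `G` induced by `C(G)` has a perfect matching. -/
theorem gallai_edmonds_b {V : Type*} [Fintype V] (G : SimpleGraph V) :
    HasPerfectMatchingF (G.induce (gallaiC G)) := by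
  classical
  obtain ⟨s, hs⟩ := exists_isMaximumMatchingFinset G
  refine ⟨Finset.univ.filter fun e => e.map Subtype.val ∈ s, ⟨fun e he => ?_, ?_⟩, fun v => ?_⟩
  · have he' := hs.1.1 _ (Finset.mem_filter.1 he).2
    induction e with
    | _ x y => simpa using he'
  · intro e he f hf hef v hve hvf
    exact hef (Sym2.map.injective Subtype.val_injective (hs.1.eq_of_mem
      (Finset.mem_filter.1 he).2 (Finset.mem_filter.1 hf).2
      (Sym2.mem_map.2 ⟨v, hve, rfl⟩) (Sym2.mem_map.2 ⟨v, hvf, rfl⟩)))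
  · obtain ⟨e, he, hve⟩ : ∃ e ∈ s, v.1 ∈ e := by
      by_contra! h
      exact v.2.1 ⟨s, hs, h⟩
    obtain ⟨w, rfl⟩ := hve
    exact ⟨s(v, ⟨w, hs.mem_gallaiC_of_mem_gallaiC v.2 he⟩), by simpa using he,
      Sym2.mem_mk_left _ _⟩
end

section
/- (rb(4, 2K₂) = 4) There exists an edge coloring of the complete graph K₄ using exactly 3 colors with no rainbow matching of size 2; moreover, every edge coloring of K₄ using at least 4 colors contains a rainbow matching of size 2. -/
/-- The number of colors used by an edge coloring `c` of the complete graph on `Fin n`: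
the cardinality of the image of `c` on the edge set. -/
def numColors {n : ℕ} (c : Sym2 (Fin n) → ℕ) : ℕ :=
  (((⊤ : SimpleGraph (Fin n)).edgeFinset).image c).card

/-- The coloring `c` of the complete graph on `Fin n` admits a rainbow matching of size `k`:
`k` pairwise disjoint edges with pairwise distinct colors. -/
def HasRainbowMatching {n : ℕ} (c : Sym2 (Fin n) → ℕ) (k : ℕ) : Prop :=
  ∃ s : Finset (Sym2 (Fin n)), s.card = k ∧ (∀ e ∈ s, ¬ e.IsDiag) ∧
    ((s : Set (Sym2 (Fin n))).Pairwise fun e f => ∀ v, v ∈ e → v ∉ f) ∧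
    Set.InjOn c ↑s

theorem hasRainbowMatching_two_iff {n : ℕ} (c : Sym2 (Fin n) → ℕ) :
    HasRainbowMatching c 2 ↔ ∃ e f : Sym2 (Fin n),
      ¬ e.IsDiag ∧ ¬ f.IsDiag ∧ (∀ v, v ∈ e → v ∉ f) ∧ c e ≠ c f := by
  constructor
  · rintro ⟨s, hs, hd, hp, hc⟩
    obtain ⟨e, f, hef, rfl⟩ := Finset.card_eq_two.mp hs
    have he : e ∈ (({e, f} : Finset (Sym2 (Fin n))) : Set (Sym2 (Fin n))) := by simp
    have hf : f ∈ (({e, f} : Finset (Sym2 (Fin n))) : Set (Sym2 (Fin n))) := by simp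
    exact ⟨e, f, hd e he, hd f hf, hp he hf hef, fun h => hef (hc he hf h)⟩
  · rintro ⟨e, f, he, hf, hd, hc⟩
    have hef : e ≠ f := fun h => hc (congrArg c h)
    refine ⟨{e, f}, Finset.card_pair hef, by simp [he, hf], ?_, ?_⟩
    · rw [Finset.coe_pair, Set.pairwise_pair]
      exact fun _ => ⟨hd, fun v hv hv' => hd v hv' hv⟩
    · rw [Finset.coe_pair, Set.injOn_pair]
      exact fun h => (hc h).elim

/-- The coloring of `K₄` whose color classes are its three perfect matchings. -/
def perfectMatchingColoring (e : Sym2 (Fin 4)) : ℕ :=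
  if e = s(0, 1) ∨ e = s(2, 3) then 0 else if e = s(0, 2) ∨ e = s(1, 3) then 1 else 2

theorem perfectMatchingColoring_eq_of_disjoint : ∀ e f : Sym2 (Fin 4),
    ¬ e.IsDiag → ¬ f.IsDiag → (∀ v, v ∈ e → v ∉ f) →
      perfectMatchingColoring e = perfectMatchingColoring f := by
  decide +kernel

theorem exists_disjoint_mem_star : ∀ e : Sym2 (Fin 4), ¬ e.IsDiag →
    ∃ f ∈ ({s(0, 1), s(0, 2), s(0, 3)} : Finset (Sym2 (Fin 4))),
      ¬ f.IsDiag ∧ (e = f ∨ ∀ v, v ∈ e → v ∉ f) := by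
  decide +kernel

/-- `rb(4, 2K₂) = 4`: there is a 3-coloring of `K₄` with no rainbow matching of size 2,
and every coloring of `K₄` with at least 4 colors has a rainbow matching of size 2. -/
theorem rb_four_two :
    (∃ c : Sym2 (Fin 4) → ℕ, numColors c = 3 ∧ ¬ HasRainbowMatching c 2) ∧
    (∀ c : Sym2 (Fin 4) → ℕ, 4 ≤ numColors c → HasRainbowMatching c 2) := by
  refine ⟨⟨perfectMatchingColoring, ?_, ?_⟩, fun c hc => ?_⟩
  · unfold numColors
    decide +kernel
  · rw [hasRainbowMatching_two_iff]
    rintro ⟨e, f, he, hf, hd, hc⟩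
    exact hc (perfectMatchingColoring_eq_of_disjoint e f he hf hd)
  · by_contra h
    rw [hasRainbowMatching_two_iff] at h
    have hsub : (⊤ : SimpleGraph (Fin 4)).edgeFinset.image c ⊆
        ({s(0, 1), s(0, 2), s(0, 3)} : Finset (Sym2 (Fin 4))).image c := by
      intro x hx
      obtain ⟨e, he, rfl⟩ := Finset.mem_image.mp hx
      have he' : ¬ e.IsDiag :=
        SimpleGraph.not_isDiag_of_mem_edgeSet _ (SimpleGraph.mem_edgeFinset.mp he)
      obtain ⟨f, hf, hfd, hef⟩ := exists_disjoint_mem_star e he'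
      refine Finset.mem_image.mpr ⟨f, hf, ?_⟩
      rcases hef with rfl | hd
      · rfl
      · by_contra hne
        exact h ⟨e, f, he', hfd, hd, Ne.symm hne⟩
    have hle : numColors c ≤ 3 :=
      (Finset.card_le_card hsub).trans (Finset.card_image_le.trans Finset.card_le_three)
    omega
end

section
/- (rb(n, 2K₂) = 2 for n ≥ 5) Let n ≥ 5. Every edge coloring of the complete graph K_n using at least 2 colors contains a rainbow matching of size 2, i.e., two disjoint edges with distinct colors. -/
/-- If disjoint edges of `K_n`, `n ≥ 5`, always have equal colors, then so do edges sharing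
a vertex. -/
theorem color_eq_of_common_vertex {α : Type*} {n : ℕ} (hn : 5 ≤ n) (c : Sym2 (Fin n) → α)
    (h : ∀ a b x y : Fin n, a ≠ b → x ≠ y → a ≠ x → a ≠ y → b ≠ x → b ≠ y →
      c s(a, b) = c s(x, y))
    {a b d : Fin n} (hab : a ≠ b) (had : a ≠ d) : c s(a, b) = c s(a, d) := by
  have hcard : 1 < (({a, b, d} : Finset (Fin n))ᶜ).card := by
    have := Finset.card_le_three (a := a) (b := b) (c := d)
    rw [Finset.card_compl, Fintype.card_fin]
    omega
  obtain ⟨x, hx, y, hy, hxy⟩ := Finset.one_lt_card.mp hcard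
  simp only [Finset.mem_compl, Finset.mem_insert, Finset.mem_singleton, not_or] at hx hy
  exact (h a b x y hab hxy (Ne.symm hx.1) (Ne.symm hy.1) (Ne.symm hx.2.1) (Ne.symm hy.2.1)).trans
    (h a d x y had hxy (Ne.symm hx.1) (Ne.symm hy.1) (Ne.symm hx.2.2) (Ne.symm hy.2.2)).symm

/-- Two disjoint edges of different colors form a rainbow matching of size 2. -/
theorem hasRainbowMatching_two {n : ℕ} (c : Sym2 (Fin n) → ℕ) {a b x y : Fin n}
    (hab : a ≠ b) (hxy : x ≠ y) (hax : a ≠ x) (hay : a ≠ y) (hbx : b ≠ x) (hby : b ≠ y)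
    (hne : c s(a, b) ≠ c s(x, y)) : HasRainbowMatching c 2 := by
  refine ⟨{s(a, b), s(x, y)}, Finset.card_pair fun he => hne (congrArg c he), ?_, ?_, ?_⟩
  · simp [hab, hxy]
  · rw [Finset.coe_pair, Set.pairwise_pair]
    intro _
    simp only [Sym2.mem_iff]
    grind
  · rw [Finset.coe_pair, Set.injOn_pair]
    exact fun he => absurd he hne

/-- `rb(n, 2K₂) = 2` for `n ≥ 5`: every edge coloring of `K_n` using at least 2 colors
contains a rainbow matching of size 2. -/
theorem rb_two_matching (n : ℕ) (hn : 5 ≤ n) (c : Sym2 (Fin n) → ℕ)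
    (hc : 2 ≤ numColors c) :
    HasRainbowMatching c 2 := by
  by_contra hno
  have h : ∀ a b x y : Fin n, a ≠ b → x ≠ y → a ≠ x → a ≠ y → b ≠ x → b ≠ y →
      c s(a, b) = c s(x, y) := by
    intro a b x y hab hxy hax hay hbx hby
    by_contra hne
    exact hno (hasRainbowMatching_two c hab hxy hax hay hbx hby hne)
  obtain ⟨_, hi, _, hj, hij⟩ := Finset.one_lt_card.mp (Nat.lt_of_succ_le hc)
  obtain ⟨e, he, rfl⟩ := Finset.mem_image.mp hi
  obtain ⟨f, hf, rfl⟩ := Finset.mem_image.mp hj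
  induction e with | _ a b
  induction f with | _ x y
  rw [SimpleGraph.mem_edgeFinset, SimpleGraph.mem_edgeSet, SimpleGraph.top_adj] at he hf
  have hadj {u v w : Fin n} : u ≠ v → u ≠ w → c s(u, v) = c s(u, w) :=
    color_eq_of_common_vertex hn c h
  by_cases hax : a = x
  · subst hax
    exact hij (hadj he hf)
  apply hij
  calc c s(a, b) = c s(a, x) := hadj he hax
    _ = c s(x, a) := by rw [Sym2.eq_swap]
    _ = c s(x, y) := hadj (Ne.symm hax) hf
end

section
/- (Lower bound of Proposition 3.2) Let k ≥ 2 and n ≥ 2k. There exists an edge coloring of the complete graph K_n using exactly max{(2k-3 choose 2), (k-2 choose 2) + (k-2)(n-k+2)} + 1 colors that contains no rainbow matching of size k. -/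
/-- The edges of the complete graph on the vertex set `S`. -/
def cliqueEdges {V : Type*} [DecidableEq V] (S : Finset V) : Finset (Sym2 V) :=
  S.sym2.filter fun e => ¬ e.IsDiag

theorem mem_cliqueEdges {V : Type*} [DecidableEq V] {S : Finset V} {e : Sym2 V} :
    e ∈ cliqueEdges S ↔ (∀ v ∈ e, v ∈ S) ∧ ¬ e.IsDiag := by
  simp [cliqueEdges, Finset.mem_sym2_iff]

theorem cliqueEdges_mono {V : Type*} [DecidableEq V] {S T : Finset V} (h : S ⊆ T) :
    cliqueEdges S ⊆ cliqueEdges T := fun _ he =>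
  mem_cliqueEdges.2 ⟨fun v hv => h ((mem_cliqueEdges.1 he).1 v hv), (mem_cliqueEdges.1 he).2⟩

theorem card_cliqueEdges {V : Type*} [DecidableEq V] (S : Finset V) :
    (cliqueEdges S).card = S.card.choose 2 := by
  rw [← Sym2.card_image_offDiag]
  congr 1
  ext e
  induction e with | _ a b
  simp only [mem_cliqueEdges, Finset.mem_image, Finset.mem_offDiag, Prod.exists, Sym2.mem_iff,
    Sym2.mk_isDiag_iff, Function.uncurry_apply_pair, Sym2.eq_iff]
  constructor
  · rintro ⟨hS, hab⟩
    exact ⟨a, b, ⟨hS a (Or.inl rfl), hS b (Or.inr rfl), hab⟩, Or.inl ⟨rfl, rfl⟩⟩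
  · grind

theorem Nat.add_choose_two_eq (a b : ℕ) :
    (a + b).choose 2 = a.choose 2 + a * b + b.choose 2 := by
  induction a with
  | zero => simp
  | succ a ih =>
    rw [show a + 1 + b = (a + b) + 1 by ring, Nat.choose_succ_succ' (a + b) 1,
      Nat.choose_succ_succ' a 1, ih]
    simp only [Nat.choose_one_right]
    ring

/-- Pairwise disjoint edges inside a vertex set `S` number at most half of `S`. -/
theorem two_mul_card_le_of_subset_cliqueEdges {V : Type*} [DecidableEq V] {S : Finset V}
    {s : Finset (Sym2 V)} (hs : s ⊆ cliqueEdges S)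
    (hd : (s : Set (Sym2 V)).Pairwise fun e f => ∀ v, v ∈ e → v ∉ f) :
    2 * s.card ≤ S.card := by
  have hcard : (s.biUnion Sym2.toFinset).card = s.card * 2 := by
    refine Finset.card_biUnion (fun e he f hf hef => ?_) |>.trans (Finset.sum_const_nat fun e he => ?_)
    · rw [Function.onFun, Finset.disjoint_left]
      intro v hv hv'
      exact hd he hf hef v (Sym2.mem_toFinset.1 hv) (Sym2.mem_toFinset.1 hv')
    · exact Sym2.card_toFinset_of_not_isDiag e (mem_cliqueEdges.1 (hs he)).2
  rw [mul_comm, ← hcard]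
  refine Finset.card_le_card (Finset.biUnion_subset.2 fun e he v hv => ?_)
  exact (mem_cliqueEdges.1 (hs he)).1 v (Sym2.mem_toFinset.1 hv)

/-- Pairwise disjoint edges that all meet `T` number at most the cardinality of `T`. -/
theorem card_le_of_forall_exists_mem {V : Type*} {T : Finset V} {s : Finset (Sym2 V)}
    (hs : ∀ e ∈ s, ∃ v ∈ T, v ∈ e)
    (hd : (s : Set (Sym2 V)).Pairwise fun e f => ∀ v, v ∈ e → v ∉ f) :
    s.card ≤ T.card := by
  rcases s.eq_empty_or_nonempty with rfl | ⟨e₀, he₀⟩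
  · simp
  have : Nonempty V := ⟨(hs e₀ he₀).choose⟩
  choose! g hgT hg using hs
  refine Finset.card_le_card_of_injOn g hgT fun e he f hf hef => ?_
  by_contra hne
  exact hd he hf hne (g e) (hg e he) (hef ▸ hg f hf)

/-- Color the edges of `E` with distinct colors and all other edges with one further color.
If `E` contains no matching of size `k - 1`, then there is no rainbow matching of size `k`. -/
theorem exists_coloring_of_matching_card_lt {n k : ℕ} (E : Finset (Sym2 (Fin n)))
    (hE : E ⊂ cliqueEdges Finset.univ)
    (hM : ∀ s ⊆ E, ((s : Set (Sym2 (Fin n))).Pairwise fun e f => ∀ v, v ∈ e → v ∉ f) →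
      s.card + 1 < k) :
    ∃ c : Sym2 (Fin n) → ℕ, numColors c = E.card + 1 ∧ ¬ HasRainbowMatching c k := by
  let g : Sym2 (Fin n) → ℕ := fun e => Fintype.equivFin (Sym2 (Fin n)) e + 1
  have hg : Function.Injective g := fun a b h => by
    simpa [g, Fin.val_inj] using h
  refine ⟨fun e => if e ∈ E then g e else 0, ?_, ?_⟩
  · have himage : ((⊤ : SimpleGraph (Fin n)).edgeFinset).image (fun e => if e ∈ E then g e else 0)
        = insert 0 (E.image g) := by
      obtain ⟨e₀, he₀, hne₀⟩ := Finset.exists_of_ssubset hE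
      have hsub : ∀ e ∈ E, ¬ e.IsDiag := fun e he => (mem_cliqueEdges.1 (hE.1 he)).2
      have hd₀ : ¬ e₀.IsDiag := (mem_cliqueEdges.1 he₀).2
      ext x
      simp only [Finset.mem_image, Finset.mem_insert, SimpleGraph.mem_edgeFinset,
        SimpleGraph.edgeSet_top, Set.mem_compl_iff, Sym2.mem_diagSet]
      constructor
      · rintro ⟨e, -, rfl⟩
        by_cases he : e ∈ E
        · exact Or.inr ⟨e, he, by simp [he]⟩
        · exact Or.inl (by simp [he])
      · rintro (rfl | ⟨e, he, rfl⟩)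
        · exact ⟨e₀, hd₀, by simp [hne₀]⟩
        · exact ⟨e, hsub e he, by simp [he]⟩
    rw [numColors, himage, Finset.card_insert_of_notMem (by simp [g]),
      Finset.card_image_of_injective _ hg]
  · rintro ⟨s, rfl, -, hd, hinj⟩
    have hlt := hM (s.filter (· ∈ E)) (fun e he => (Finset.mem_filter.1 he).2)
      (hd.mono (Finset.coe_subset.2 (Finset.filter_subset _ s)))
    have hle : (s.filter (· ∉ E)).card ≤ 1 := by
      refine Finset.card_le_one.2 fun e he f hf => ?_
      rw [Finset.mem_filter] at he hf
      exact hinj he.1 hf.1 (by simp [he.2, hf.2])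
    have := Finset.card_filter_add_card_filter_not (s := s) (· ∈ E)
    omega

theorem exists_edge_avoiding {n : ℕ} {S : Finset (Fin n)} (hS : S.card + 2 ≤ n) :
    ∃ e ∈ cliqueEdges (Finset.univ : Finset (Fin n)), ∀ v ∈ e, v ∉ S := by
  have hcard : 1 < Sᶜ.card := by
    rw [Finset.card_compl, Fintype.card_fin]; omega
  obtain ⟨a, ha, b, hb, hab⟩ := Finset.one_lt_card.1 hcard
  rw [Finset.mem_compl] at ha hb
  refine ⟨s(a, b), mem_cliqueEdges.2 ⟨by simp, by simpa using hab⟩, ?_⟩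
  intro v hv
  rcases Sym2.mem_iff.1 hv with rfl | rfl <;> assumption

theorem exists_coloring_clique {n k : ℕ} (hk : 2 ≤ k) (hn : 2 * k ≤ n) :
    ∃ c : Sym2 (Fin n) → ℕ,
      numColors c = (2 * k - 3).choose 2 + 1 ∧ ¬ HasRainbowMatching c k := by
  obtain ⟨S, -, hS⟩ := Finset.exists_subset_card_eq
    (s := (Finset.univ : Finset (Fin n))) (n := 2 * k - 3) (by simp; omega)
  rw [← hS, ← card_cliqueEdges]
  refine exists_coloring_of_matching_card_lt _ ?_ fun s hs hd => ?_
  · obtain ⟨e, he, hav⟩ := exists_edge_avoiding (S := S) (by omega)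
    refine Finset.ssubset_iff_subset_ne.2 ⟨cliqueEdges_mono (Finset.subset_univ S), ?_⟩
    rintro heq
    rw [← heq] at he
    exact hav _ e.out_fst_mem ((mem_cliqueEdges.1 he).1 _ e.out_fst_mem)
  · have := two_mul_card_le_of_subset_cliqueEdges hs hd
    omega

theorem exists_coloring_cover {n k : ℕ} (hk : 2 ≤ k) (hn : 2 * k ≤ n) :
    ∃ c : Sym2 (Fin n) → ℕ,
      numColors c = (k - 2).choose 2 + (k - 2) * (n - k + 2) + 1 ∧
        ¬ HasRainbowMatching c k := by
  obtain ⟨T, -, hT⟩ := Finset.exists_subset_card_eq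
    (s := (Finset.univ : Finset (Fin n))) (n := k - 2) (by simp; omega)
  have hcard : (cliqueEdges Finset.univ \ cliqueEdges Tᶜ).card
      = (k - 2).choose 2 + (k - 2) * (n - k + 2) := by
    rw [Finset.card_sdiff_of_subset (cliqueEdges_mono (Finset.subset_univ _)),
      card_cliqueEdges, card_cliqueEdges, Finset.card_compl, Finset.card_univ, Fintype.card_fin,
      hT, show n - (k - 2) = n - k + 2 by omega]
    have := Nat.add_choose_two_eq (k - 2) (n - k + 2)
    rw [show k - 2 + (n - k + 2) = n by omega] at this
    omega
  rw [← hcard]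
  refine exists_coloring_of_matching_card_lt _ ?_ fun s hs hd => ?_
  · obtain ⟨e, he, hav⟩ := exists_edge_avoiding (S := T) (by omega)
    refine Finset.ssubset_iff_subset_ne.2 ⟨Finset.sdiff_subset, ?_⟩
    intro heq
    have he' := he
    rw [← heq] at he'
    exact (Finset.mem_sdiff.1 he').2 (mem_cliqueEdges.2
      ⟨fun v hv => Finset.mem_compl.2 (hav v hv), (mem_cliqueEdges.1 he).2⟩)
  · have := card_le_of_forall_exists_mem (T := T) (fun e he => ?_) hd
    · omega
    · obtain ⟨he₁, he₂⟩ := Finset.mem_sdiff.1 (hs he)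
      by_contra! hav
      exact he₂ (mem_cliqueEdges.2
        ⟨fun v hv => Finset.mem_compl.2 fun hvT => hav v hvT hv, (mem_cliqueEdges.1 he₁).2⟩)

/-- Lower bound of Proposition 3.2: for `k ≥ 2` and `n ≥ 2k` there is an edge coloring of
`K_n` with exactly `ext(n, (k-1)K₂) + 1` colors and no rainbow matching of size `k`. -/
theorem rb_lower_bound (n k : ℕ) (hk : 2 ≤ k) (hn : 2 * k ≤ n) :
    ∃ c : Sym2 (Fin n) → ℕ,
      numColors c
        = max (Nat.choose (2 * k - 3) 2) (Nat.choose (k - 2) 2 + (k - 2) * (n - k + 2)) + 1 ∧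
      ¬ HasRainbowMatching c k := by
  rcases max_choice (Nat.choose (2 * k - 3) 2)
    (Nat.choose (k - 2) 2 + (k - 2) * (n - k + 2)) with h | h <;> rw [h]
  · exact exists_coloring_clique hk hn
  · exact exists_coloring_cover hk hn
end

section
/- (Upper bound of Proposition 3.2) Let k ≥ 2 and n ≥ 2k. Every edge coloring of the complete graph K_n using at least max{(2k-1 choose 2), (k-1 choose 2) + (k-1)(n-k+1)} + 1 colors contains a rainbow matching of size k. -/
/-- The `(i, j)`-shift of `e` relative to `A`: `j` is replaced by `i` when the result is a set
outside `A`. -/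
def shiftSet (A : Finset (Finset ℕ)) (i j : ℕ) (e : Finset ℕ) : Finset ℕ :=
  if j ∈ e ∧ i ∉ e ∧ e.image (Equiv.swap i j) ∉ A then e.image (Equiv.swap i j) else e

theorem mem_image_swap {i j x : ℕ} {e : Finset ℕ} :
    x ∈ e.image (Equiv.swap i j) ↔ Equiv.swap i j x ∈ e := by
  rw [Finset.mem_image]
  constructor
  · rintro ⟨y, hy, rfl⟩
    simpa using hy
  · exact fun h => ⟨_, h, by simp⟩

theorem image_swap_image_swap (i j : ℕ) (e : Finset ℕ) :
    (e.image (Equiv.swap i j)).image (Equiv.swap i j) = e := by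
  ext x
  simp

theorem image_swap_injective (i j : ℕ) :
    Function.Injective fun e : Finset ℕ => e.image (Equiv.swap i j) :=
  Finset.image_injective (Equiv.injective _)

theorem image_swap_eq_self {i j : ℕ} {e : Finset ℕ} (hi : i ∉ e) (hj : j ∉ e) :
    e.image (Equiv.swap i j) = e := by
  ext x
  rw [mem_image_swap]
  grind

theorem image_swap_eq_insert_erase {i j : ℕ} {e : Finset ℕ} (hj : j ∈ e) (hi : i ∉ e) :
    e.image (Equiv.swap i j) = insert i (e.erase j) := by
  ext x
  rw [mem_image_swap]
  grind

theorem card_image_shiftSet (A : Finset (Finset ℕ)) (i j : ℕ) :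
    (A.image (shiftSet A i j)).card = A.card := by
  refine Finset.card_image_of_injOn fun e he f hf h => ?_
  have := @image_swap_injective i j e f
  simp only [shiftSet] at h
  simp only [Finset.mem_coe] at he hf
  grind

theorem shiftSet_mem_powersetCard {A : Finset (Finset ℕ)} {i j n r : ℕ} (hij : i < j)
    {e : Finset ℕ} (he : e ∈ (Finset.range n).powersetCard r) :
    shiftSet A i j e ∈ (Finset.range n).powersetCard r := by
  rw [shiftSet]
  split_ifs with h
  · rw [Finset.mem_powersetCard] at he ⊢
    refine ⟨?_, by rw [Finset.card_image_of_injective _ (Equiv.injective _), he.2]⟩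
    rw [image_swap_eq_insert_erase h.1 h.2.1]
    intro x hx
    have := he.1 h.1
    have := @he.1 x
    grind
  · exact he

theorem sum_image_swap_lt {i j : ℕ} (hij : i < j) {e : Finset ℕ} (hj : j ∈ e) (hi : i ∉ e) :
    ∑ x ∈ e.image (Equiv.swap i j), x < ∑ x ∈ e, x := by
  rw [image_swap_eq_insert_erase hj hi, Finset.sum_insert (by simp [hi]),
    ← Finset.add_sum_erase e _ hj]
  omega

theorem sum_shiftSet_le {A : Finset (Finset ℕ)} {i j : ℕ} (hij : i < j) (e : Finset ℕ) :
    ∑ x ∈ shiftSet A i j e, x ≤ ∑ x ∈ e, x := by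
  rw [shiftSet]
  split_ifs with h
  · exact (sum_image_swap_lt hij h.1 h.2.1).le
  · exact le_rfl

theorem sum_sum_image_shiftSet_lt {A : Finset (Finset ℕ)} {i j : ℕ} (hij : i < j)
    {e : Finset ℕ} (he : e ∈ A) (hj : j ∈ e) (hi : i ∉ e)
    (hA : e.image (Equiv.swap i j) ∉ A) :
    ∑ f ∈ A.image (shiftSet A i j), ∑ x ∈ f, x < ∑ f ∈ A, ∑ x ∈ f, x := by
  rw [Finset.sum_image (Finset.card_image_iff.1 (card_image_shiftSet A i j))]
  refine Finset.sum_lt_sum (fun f _ => sum_shiftSet_le hij f) ⟨e, he, ?_⟩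
  rw [shiftSet, if_pos ⟨hj, hi, hA⟩]
  exact sum_image_swap_lt hij hj hi

/-- `A` contains `k` pairwise disjoint sets. -/
def HasMatching (A : Finset (Finset ℕ)) (k : ℕ) : Prop :=
  ∃ M ⊆ A, M.card = k ∧ (M : Set (Finset ℕ)).Pairwise Disjoint

theorem HasMatching.of_image_shiftSet {A : Finset (Finset ℕ)} {i j k : ℕ}
    (h : HasMatching (A.image (shiftSet A i j)) k) : HasMatching A k := by
  obtain ⟨M, hM, hk, hd⟩ := h
  by_cases hMA : M ⊆ A
  · exact ⟨M, hMA, hk, hd⟩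
  obtain ⟨e, he, heA⟩ := Finset.not_subset.1 hMA
  have key : ∀ g ∈ M, g ∉ A → i ∈ g ∧ j ∉ g ∧ g.image (Equiv.swap i j) ∈ A := by
    intro g hg hgA
    obtain ⟨f, hf, rfl⟩ := Finset.mem_image.1 (hM hg)
    rw [shiftSet] at hgA ⊢
    split_ifs at hgA ⊢ with h
    · rw [image_swap_image_swap, mem_image_swap, mem_image_swap]
      simpa [h.1, h.2.1] using hf
    · exact absurd hf hgA
  have hstay : ∀ g ∈ M, g ∈ A → j ∈ g → i ∉ g → g.image (Equiv.swap i j) ∈ A := by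
    intro g hg hgA hj hi
    obtain ⟨f, hf, rfl⟩ := Finset.mem_image.1 (hM hg)
    by_contra hcon
    rw [shiftSet] at hj hi hcon
    split_ifs at hj hi hcon with h
    · exact hi (by rw [mem_image_swap]; simpa using h.1)
    · exact h ⟨hj, hi, hcon⟩
  have hei := key e he heA
  refine ⟨M.image fun e => e.image (Equiv.swap i j), ?_, ?_, ?_⟩
  · intro g' hg'
    obtain ⟨g, hg, rfl⟩ := Finset.mem_image.1 hg'
    by_cases hgA : g ∈ A
    · have hne : g ≠ e := fun h => heA (h ▸ hgA)
      have hi : i ∉ g := fun h => Finset.disjoint_left.1 (hd hg he hne) h hei.1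
      by_cases hj : j ∈ g
      · exact hstay g hg hgA hj hi
      · simpa only [image_swap_eq_self hi hj] using hgA
    · exact (key g hg hgA).2.2
  · rw [Finset.card_image_of_injective _ (image_swap_injective i j), hk]
  · rw [Finset.coe_image]
    rintro _ ⟨g, hg, rfl⟩ _ ⟨f, hf, rfl⟩ hne
    exact (Finset.disjoint_image (Equiv.injective _)).2 (hd hg hf fun h => hne (h ▸ rfl))

theorem choose_two_add_mul_le_max {n k i : ℕ} (hn : 2 * k ≤ n) (hi : i < k) :
    (2 * k - 1 - i).choose 2 + i * (n - (2 * k - 1 - i)) ≤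
      max ((2 * k - 1).choose 2) ((k - 1).choose 2 + (k - 1) * (n - k + 1)) := by
  obtain ⟨d, rfl⟩ := Nat.exists_eq_add_of_lt hi
  obtain ⟨m, rfl⟩ := Nat.exists_eq_add_of_le hn
  have h1 : 2 * (i + d + 1) - 1 - i = i + 2 * d + 1 := by omega
  have h2 : 2 * (i + d + 1) - 1 = 2 * i + 2 * d + 1 := by omega
  have h3 : i + d + 1 - 1 = i + d := by omega
  have h4 : 2 * (i + d + 1) + m - (i + 2 * d + 1) = i + 1 + m := by omega
  have h5 : 2 * (i + d + 1) + m - (i + d + 1) + 1 = i + d + 2 + m := by omega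
  rw [h1, h2, h3, h4, h5, le_max_iff]
  by_contra! hcon
  obtain ⟨ha, hb⟩ := hcon
  have hc (t : ℕ) : (t.choose 2 : ℚ) = t * (t - 1) / 2 := Nat.cast_choose_two ℚ t
  have ha' := (Nat.cast_lt (α := ℚ)).2 ha
  have hb' := (Nat.cast_lt (α := ℚ)).2 hb
  push_cast [hc] at ha' hb'
  have hi0 : (0 : ℚ) ≤ i := by positivity
  have hd0 : (0 : ℚ) ≤ d := by positivity
  have hm0 : (0 : ℚ) ≤ m := by positivity
  have e1 : 0 < (i : ℚ) * (2 * m + 1 - i - 4 * d) := by nlinarith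
  have e2 : (d : ℚ) * (2 * m + 1 + 2 * i - d) < 0 := by nlinarith
  have f1 : 0 < (2 * m + 1 - i - 4 * d : ℚ) := pos_of_mul_pos_right e1 hi0
  have f2 : (2 * m + 1 + 2 * i - d : ℚ) < 0 := by
    by_contra! h
    exact absurd (mul_nonneg hd0 h) (not_le.2 e2)
  linarith

theorem card_le_of_shifted {A : Finset (Finset ℕ)} {n k : ℕ} (hn : 2 * k ≤ n)
    (hA : A ⊆ (Finset.range n).powersetCard 2) (hk : ¬ HasMatching A k)
    (hs : ∀ e ∈ A, ∀ i j, i < j → j ∈ e → i ∉ e → e.image (Equiv.swap i j) ∈ A) :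
    A.card ≤ max ((2 * k - 1).choose 2) ((k - 1).choose 2 + (k - 1) * (n - k + 1)) := by
  obtain ⟨i, hik, hi⟩ : ∃ i < k, ({i, 2 * k - 1 - i} : Finset ℕ) ∉ A := by
    by_contra! h
    have hdisj : ∀ a < k, ∀ b < k, a ≠ b →
        Disjoint ({a, 2 * k - 1 - a} : Finset ℕ) {b, 2 * k - 1 - b} := by
      intro a ha b hb hab
      simp only [Finset.disjoint_left, Finset.mem_insert, Finset.mem_singleton]
      omega
    refine hk ⟨(Finset.range k).image fun a => {a, 2 * k - 1 - a}, ?_, ?_, ?_⟩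
    · intro e he
      obtain ⟨a, ha, rfl⟩ := Finset.mem_image.1 he
      exact h a (Finset.mem_range.1 ha)
    · rw [Finset.card_image_of_injOn, Finset.card_range]
      intro a ha b hb hab
      by_contra hne
      have := hdisj a (by simpa using ha) b (by simpa using hb) hne
      simp only at hab
      simp [hab] at this
    · rw [Finset.coe_image]
      rintro _ ⟨a, ha, rfl⟩ _ ⟨b, hb, rfl⟩ hne
      exact hdisj a (by simpa using ha) b (by simpa using hb) fun h => hne (h ▸ rfl)
  have hlow : ∀ a b, a < b → ({a, b} : Finset ℕ) ∈ A → i ≤ a → b < 2 * k - 1 - i := by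
    intro a b hab he hia
    by_contra! hb
    have h1 : ({i, b} : Finset ℕ) ∈ A := by
      rcases hia.eq_or_lt with rfl | hlt
      · exact he
      · have hni : i ∉ ({a, b} : Finset ℕ) := by simp; omega
        have := hs _ he i a hlt (by simp) hni
        rw [image_swap_eq_insert_erase (by simp) hni] at this
        convert this using 1
        ext x; simp; omega
    rcases hb.eq_or_lt with rfl | hlt
    · exact hi h1
    · have hni : 2 * k - 1 - i ∉ ({i, b} : Finset ℕ) := by simp; omega
      have := hs _ h1 _ b hlt (by simp) hni
      rw [image_swap_eq_insert_erase (by simp) hni] at this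
      refine hi ?_
      convert this using 1
      ext x; simp; omega
  have hsub : A ⊆ (Finset.range (2 * k - 1 - i)).powersetCard 2 ∪
      (Finset.range i ×ˢ Finset.Ico (2 * k - 1 - i) n).image fun p => {p.1, p.2} := by
    intro e he
    obtain ⟨hr, hc⟩ := Finset.mem_powersetCard.1 (hA he)
    obtain ⟨a, b, hab, rfl⟩ : ∃ a b, a < b ∧ e = {a, b} := by
      obtain ⟨a, b, hne, rfl⟩ := Finset.card_eq_two.1 hc
      rcases hne.lt_or_gt with h | h
      · exact ⟨a, b, h, rfl⟩
      · exact ⟨b, a, h, Finset.pair_comm _ _⟩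
    have hbn : b < n := Finset.mem_range.1 (hr (by simp))
    rw [Finset.mem_union]
    by_cases hb : b < 2 * k - 1 - i
    · left
      rw [Finset.mem_powersetCard]
      refine ⟨fun x hx => ?_, hc⟩
      simp only [Finset.mem_insert, Finset.mem_singleton] at hx
      rw [Finset.mem_range]
      omega
    · right
      have : a < i := by
        by_contra! h
        exact hb (hlow a b hab he h)
      exact Finset.mem_image.2 ⟨(a, b), by simp; omega, rfl⟩
  calc A.card ≤ _ := Finset.card_le_card hsub
    _ ≤ _ := Finset.card_union_le _ _
    _ ≤ (2 * k - 1 - i).choose 2 + i * (n - (2 * k - 1 - i)) := by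
      refine add_le_add (by simp) (Finset.card_image_le.trans (by simp))
    _ ≤ _ := choose_two_add_mul_le_max hn hik

/-- The Erdős–Gallai bound on the number of edges of a graph without a matching of size `k`. -/
theorem card_le_of_not_hasMatching {n k : ℕ} (hn : 2 * k ≤ n) (A : Finset (Finset ℕ))
    (hA : A ⊆ (Finset.range n).powersetCard 2) (hk : ¬ HasMatching A k) :
    A.card ≤ max ((2 * k - 1).choose 2) ((k - 1).choose 2 + (k - 1) * (n - k + 1)) := by
  induction hw : ∑ e ∈ A, ∑ x ∈ e, x using Nat.strong_induction_on generalizing A with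
  | _ w ih =>
    subst hw
    by_cases hs : ∀ e ∈ A, ∀ i j, i < j → j ∈ e → i ∉ e → e.image (Equiv.swap i j) ∈ A
    · exact card_le_of_shifted hn hA hk hs
    · push Not at hs
      obtain ⟨e, he, i, j, hij, hj, hi, hnA⟩ := hs
      rw [← card_image_shiftSet A i j]
      refine ih _ (sum_sum_image_shiftSet_lt hij he hj hi hnA) _ ?_
        (fun h => hk h.of_image_shiftSet) rfl
      intro f hf
      obtain ⟨g, hg, rfl⟩ := Finset.mem_image.1 hf
      exact shiftSet_mem_powersetCard hij (hA hg)

/-- The set of values of the endpoints of an edge. -/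
def endpointValues {n : ℕ} (e : Sym2 (Fin n)) : Finset ℕ :=
  e.toFinset.image Fin.val

theorem val_mem_endpointValues {n : ℕ} {e : Sym2 (Fin n)} {v : Fin n} :
    (v : ℕ) ∈ endpointValues e ↔ v ∈ e := by
  simp [endpointValues, Fin.val_inj]

theorem endpointValues_injective {n : ℕ} :
    Function.Injective (endpointValues : Sym2 (Fin n) → Finset ℕ) := fun e f h =>
  Sym2.ext fun v => by rw [← val_mem_endpointValues, h, val_mem_endpointValues]

theorem endpointValues_mem_powersetCard {n : ℕ} {e : Sym2 (Fin n)} (he : ¬ e.IsDiag) :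
    endpointValues e ∈ (Finset.range n).powersetCard 2 := by
  rw [Finset.mem_powersetCard]
  constructor
  · intro x hx
    obtain ⟨v, -, rfl⟩ := Finset.mem_image.1 hx
    exact Finset.mem_range.2 v.2
  · rw [endpointValues, Finset.card_image_of_injective _ Fin.val_injective,
      Sym2.card_toFinset_of_not_isDiag _ he]

/-- Upper bound of Proposition 3.2: for `k ≥ 2` and `n ≥ 2k`, every edge coloring of `K_n`
using at least `ext(n, kK₂) + 1` colors contains a rainbow matching of size `k`. -/
theorem rb_upper_bound (n k : ℕ) (hk : 2 ≤ k) (hn : 2 * k ≤ n) (c : Sym2 (Fin n) → ℕ)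
    (hc : max (Nat.choose (2 * k - 1) 2) (Nat.choose (k - 1) 2 + (k - 1) * (n - k + 1)) + 1
      ≤ numColors c) :
    HasRainbowMatching c k := by
  obtain ⟨T, hT, hcard, hinj⟩ : ∃ T ⊆ (⊤ : SimpleGraph (Fin n)).edgeFinset,
      T.card = numColors c ∧ Set.InjOn c T := by
    obtain ⟨T, hT, hinj, hTc⟩ := Finset.exists_subset_injOn_image_eq_of_surjOn
      (f := c) (s := ((⊤ : SimpleGraph (Fin n)).edgeFinset : Set (Sym2 (Fin n))))
      ((⊤ : SimpleGraph (Fin n)).edgeFinset.image c) (by simp [Set.SurjOn])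
    exact ⟨T, Finset.coe_subset.1 hT,
      by rw [numColors, ← hTc, Finset.card_image_of_injOn hinj], hinj⟩
  have hdiag : ∀ e ∈ T, ¬ e.IsDiag := fun e he => by simpa using hT he
  have hmatch : HasMatching (T.image endpointValues) k := by
    by_contra hno
    have := card_le_of_not_hasMatching hn _ (fun f hf => by
      obtain ⟨e, he, rfl⟩ := Finset.mem_image.1 hf
      exact endpointValues_mem_powersetCard (hdiag e he)) hno
    rw [Finset.card_image_of_injective _ endpointValues_injective, hcard] at this
    omega
  obtain ⟨M, hM, hMk, hMd⟩ := hmatch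
  obtain ⟨s, hs, rfl⟩ := Finset.subset_image_iff.1 hM
  rw [Finset.card_image_of_injective _ endpointValues_injective] at hMk
  refine ⟨s, hMk, fun e he => hdiag e (hs he), fun e he f hf hne v hv hv' => ?_,
    hinj.mono (Finset.coe_subset.2 hs)⟩
  exact Finset.disjoint_left.1 (hMd (Finset.mem_coe.2 (Finset.mem_image_of_mem _ he))
    (Finset.mem_coe.2 (Finset.mem_image_of_mem _ hf)) (endpointValues_injective.ne hne))
    (val_mem_endpointValues.2 hv) (val_mem_endpointValues.2 hv')
end
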